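/- For arbitrary strict partitions λ and μ, one has the integer identity (|λ| − |μ|) · Σ_{D ∈ E^D(λ/μ)} ∏_{u ∈ D} h^D(u) = Σ_{ν : μ ⋖ ν ⊆ λ} Σ_{D ∈ E^D(λ/ν)} ∏_{u ∈ D} h^D(u), where the outer sum on the right is over all strict partitions ν with μ ⋖ ν and ν ⊆ λ. -/

import Mathlib

attribute [local instance] Classical.propDecidable

/-- `l : ℕ → ℕ` encodes a strict partition: the parts are `l 1 > l 2 > ⋯ > l ℓ > 0`
(indexed from `1`), with `l i = 0` for `i > ℓ` (and `l 0 = 0` by convention). -/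
def IsStrictPartition (l : ℕ → ℕ) : Prop :=
  l 0 = 0 ∧ ∀ i, 1 ≤ i → (l i = 0 → l (i + 1) = 0) ∧ (l i ≠ 0 → l (i + 1) < l i)

/-- The shifted diagram of type B: cells `(i,j)` with `1 ≤ i ≤ ℓ(λ)` and
`i ≤ j ≤ λ_i + i - 1`.  (For a strict partition all such cells satisfy
`i ≤ l 1` and `j ≤ 2 * l 1 + 2`, so the ambient box loses nothing.) -/
noncomputable def cellsB (l : ℕ → ℕ) : Finset (ℕ × ℕ) :=
  (Finset.Icc 1 (l 1) ×ˢ Finset.Icc 1 (2 * l 1 + 2)).filter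
    (fun p => p.1 ≤ p.2 ∧ p.2 < l p.1 + p.1)

/-- The shifted diagram of type D: cells `(i,j)` with `1 ≤ i ≤ ℓ(λ)` and
`i + 1 ≤ j ≤ λ_i + i`. -/
noncomputable def cellsD (l : ℕ → ℕ) : Finset (ℕ × ℕ) :=
  (Finset.Icc 1 (l 1) ×ˢ Finset.Icc 1 (2 * l 1 + 2)).filter
    (fun p => p.1 < p.2 ∧ p.2 ≤ l p.1 + p.1)

/-- `λ'_k`: the number of cells of `[λ]^B` in column `k`. -/
noncomputable def colB (l : ℕ → ℕ) (k : ℕ) : ℕ :=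
  ((cellsB l).filter (fun p => p.2 = k)).card

/-- The size `|λ|` of a strict partition. -/
noncomputable def spSize (l : ℕ → ℕ) : ℕ := ∑ i ∈ Finset.Icc 1 (l 1), l i

/-- The length `ℓ(λ)` (number of nonzero parts) of a strict partition. -/
noncomputable def spLength (l : ℕ → ℕ) : ℕ :=
  ((Finset.Icc 1 (l 1)).filter (fun i => l i ≠ 0)).card

/-- `μ ⋖ ν` for strict partitions (containment via type B diagrams and `|ν| = |μ| + 1`). -/
def CoversB (m n : ℕ → ℕ) : Prop :=
  cellsB m ⊆ cellsB n ∧ spSize n = spSize m + 1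

/-- `μ ⋖ ν` for strict partitions (containment via type D diagrams and `|ν| = |μ| + 1`). -/
def CoversD (m n : ℕ → ℕ) : Prop :=
  cellsD m ⊆ cellsD n ∧ spSize n = spSize m + 1

/-- An excited move of type B with respect to `λ`. -/
def ExcitedMoveB (l : ℕ → ℕ) (D D' : Finset (ℕ × ℕ)) : Prop :=
  ∃ i j : ℕ, (i, j) ∈ D ∧
    (i + 1, j) ∈ cellsB l ∧ (i + 1, j) ∉ D ∧
    (i, j + 1) ∈ cellsB l ∧ (i, j + 1) ∉ D ∧
    (i + 1, j + 1) ∈ cellsB l ∧ (i + 1, j + 1) ∉ D ∧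
    D' = insert (i + 1, j + 1) (D.erase (i, j))

/-- The excited diagrams of type B of shape `λ/μ`: subsets of `[λ]^B` obtainable from
`[μ]^B` by finite sequences of excited moves of type B. -/
noncomputable def EB (l m : ℕ → ℕ) : Finset (Finset (ℕ × ℕ)) :=
  (cellsB l).powerset.filter
    (fun D => Relation.ReflTransGen (ExcitedMoveB l) (cellsB m) D)

/-- An excited move of type D with respect to `λ`. -/
def ExcitedMoveD (l : ℕ → ℕ) (D D' : Finset (ℕ × ℕ)) : Prop :=
  (∃ i j : ℕ, i + 1 < j ∧ (i, j) ∈ D ∧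
    (i + 1, j) ∈ cellsD l ∧ (i + 1, j) ∉ D ∧
    (i, j + 1) ∈ cellsD l ∧ (i, j + 1) ∉ D ∧
    (i + 1, j + 1) ∈ cellsD l ∧ (i + 1, j + 1) ∉ D ∧
    D' = insert (i + 1, j + 1) (D.erase (i, j))) ∨
  (∃ i : ℕ, (i, i + 1) ∈ D ∧
    (i, i + 2) ∈ cellsD l ∧ (i, i + 2) ∉ D ∧
    (i, i + 3) ∈ cellsD l ∧ (i, i + 3) ∉ D ∧
    (i + 1, i + 2) ∈ cellsD l ∧ (i + 1, i + 2) ∉ D ∧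
    (i + 1, i + 3) ∈ cellsD l ∧ (i + 1, i + 3) ∉ D ∧
    (i + 2, i + 3) ∈ cellsD l ∧ (i + 2, i + 3) ∉ D ∧
    D' = insert (i + 2, i + 3) (D.erase (i, i + 1)))

/-- The excited diagrams of type D of shape `λ/μ`. -/
noncomputable def ED (l m : ℕ → ℕ) : Finset (Finset (ℕ × ℕ)) :=
  (cellsD l).powerset.filter
    (fun D => Relation.ReflTransGen (ExcitedMoveD l) (cellsD m) D)

/-- The set `W^B(μ, λ)`: all `1 ≤ k ≤ ℓ(λ)` with `λ_k ≠ μ_i` for all `i ≥ 1`, together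
with all `k ≥ ℓ(λ) + 1` with `λ'_k - k ≠ μ'_i - i` for all `i ≥ 1`.  (All its elements
are at most `λ_1 + μ_1 + 2`, so the ambient interval loses nothing.) -/
noncomputable def WB (m l : ℕ → ℕ) : Finset ℕ :=
  (Finset.Icc 1 (l 1 + m 1 + 2)).filter (fun k =>
    (k ≤ spLength l ∧ ∀ i, 1 ≤ i → l k ≠ m i) ∨
    (spLength l + 1 ≤ k ∧ ∀ i, 1 ≤ i → (colB l k : ℤ) - k ≠ (colB m i : ℤ) - i))

/-- The set `W^D(μ, λ)`. -/
noncomputable def WD (m l : ℕ → ℕ) : Finset ℕ :=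
  (Finset.Icc 1 (l 1 + m 1 + 3)).filter (fun k =>
    (k ≤ spLength l ∧ ∀ i, 1 ≤ i → l k ≠ m i) ∨
    (k = spLength l + 1 ∧ Odd ((spLength l : ℤ) - (spLength m : ℤ))) ∨
    (spLength l + 2 ≤ k ∧ ∀ i, 1 ≤ i → (colB l k : ℤ) - k ≠ (colB m i : ℤ) - i))

/-- The type B hook length of a cell of `[λ]^B`. -/
noncomputable def hB (l : ℕ → ℕ) (p : ℕ × ℕ) : ℤ :=
  if p.1 = p.2 then (l p.1 : ℤ)
  else if p.2 ≤ spLength l then (l p.1 : ℤ) + (l p.2 : ℤ)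
  else ((l p.1 : ℤ) + (p.1 : ℤ) - (p.2 : ℤ)) + ((colB l p.2 : ℤ) - (p.1 : ℤ))

/-- The type D hook length of a cell of `[λ]^D`. -/
noncomputable def hD (l : ℕ → ℕ) (p : ℕ × ℕ) : ℤ :=
  if p.2 ≤ spLength l then (l p.1 : ℤ) + (l p.2 : ℤ)
  else ((l p.1 : ℤ) + (p.1 : ℤ) - (p.2 : ℤ) + 1) + ((colB l (p.2 - 1) : ℤ) - (p.1 : ℤ))

/-- A standard Young tableau on a finite set of cells, encoded as `T : ℕ × ℕ → ℕ`
which is `0` off the cells and restricts to a bijection onto `{1, …, n}`,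
increasing along rows and columns. -/
def IsSYT (cells : Finset (ℕ × ℕ)) (T : ℕ × ℕ → ℕ) : Prop :=
  Set.BijOn T ↑cells ↑(Finset.Icc 1 cells.card) ∧
  (∀ p, p ∉ cells → T p = 0) ∧
  (∀ i j : ℕ, (i, j) ∈ cells → (i, j + 1) ∈ cells → T (i, j) < T (i, j + 1)) ∧
  (∀ i j : ℕ, (i, j) ∈ cells → (i + 1, j) ∈ cells → T (i, j) < T (i + 1, j))

/-- The skew diagram `[λ]^B ∖ [μ]^B`. -/
noncomputable def skewB (l m : ℕ → ℕ) : Finset (ℕ × ℕ) := cellsB l \ cellsB m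

/-- The skew diagram `[λ]^D ∖ [μ]^D`. -/
noncomputable def skewD (l m : ℕ → ℕ) : Finset (ℕ × ℕ) := cellsD l \ cellsD m

/-- `f^{λ/μ}`: the number of standard Young tableaux of shifted skew shape `λ/μ`
(type B diagrams). -/
noncomputable def fB (l m : ℕ → ℕ) : ℕ :=
  Nat.card {T : ℕ × ℕ → ℕ // IsSYT (skewB l m) T}

/-- `f^{λ/μ}` via the type D diagrams. -/
noncomputable def fD (l m : ℕ → ℕ) : ℕ :=
  Nat.card {T : ℕ × ℕ → ℕ // IsSYT (skewD l m) T}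

/-- `x_k^B = λ_k` for `k ≤ ℓ(λ)` and `x_k^B = λ'_k - k` for `k > ℓ(λ)`. -/
noncomputable def xB (l : ℕ → ℕ) (k : ℕ) : ℤ :=
  if k ≤ spLength l then (l k : ℤ) else (colB l k : ℤ) - (k : ℤ)

/-- `x_k^D = λ_k` for `k ≤ ℓ(λ)` and `x_k^D = λ'_{k-1} - k + 1` for `k > ℓ(λ)`. -/
noncomputable def xD (l : ℕ → ℕ) (k : ℕ) : ℤ :=
  if k ≤ spLength l then (l k : ℤ) else (colB l (k - 1) : ℤ) - (k : ℤ) + 1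

/-- The weighted type B hook length `h^B(u; z)`: the sum of `z_{c(v)}` over the cells `v`
of the type B hook of `u` (the diagonal cell `(j,j)` counted twice when `i < j ≤ ℓ(λ)`). -/
noncomputable def hBz (l : ℕ → ℕ) (z : ℕ → ℝ) (u : ℕ × ℕ) : ℝ :=
  (∑ p ∈ (cellsB l).filter (fun p => p.1 = u.1 ∧ u.2 ≤ p.2), z (p.2 - p.1)) +
  (∑ p ∈ (cellsB l).filter (fun p => p.2 = u.2 ∧ u.1 < p.1), z (p.2 - p.1)) +
  (if u.1 < u.2 ∧ u.2 ≤ spLength l then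
      ∑ p ∈ (cellsB l).filter (fun p => p.1 = u.2), z (p.2 - p.1)
    else 0)

/-- The weighted type D hook length `h^D(u; z)`. -/
noncomputable def hDz (l : ℕ → ℕ) (z : ℕ → ℝ) (u : ℕ × ℕ) : ℝ :=
  (∑ p ∈ (cellsD l).filter (fun p => p.1 = u.1 ∧ u.2 ≤ p.2), z (p.2 - p.1)) +
  (∑ p ∈ (cellsD l).filter (fun p => p.2 = u.2 ∧ u.1 < p.1), z (p.2 - p.1)) +
  (∑ p ∈ (cellsD l).filter (fun p => p.1 = u.2), z (p.2 - p.1))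

/-- The weight `T_z` of a standard Young tableau `T` on `cells` (with `n = |cells|`):
`∏_{k=1}^n (z_{c(T⁻¹(n))} + ⋯ + z_{c(T⁻¹(k))})⁻¹`. -/
noncomputable def Tz (cells : Finset (ℕ × ℕ)) (z : ℕ → ℝ) (T : ℕ × ℕ → ℕ) : ℝ :=
  ∏ k ∈ Finset.Icc 1 cells.card,
    (∑ p ∈ cells.filter (fun p => k ≤ T p), z (p.2 - p.1))⁻¹

/-- `x_k^B(z) = z_0 + ⋯ + z_{λ_k - 1}` for `k ≤ ℓ(λ)`, and
`x_k^B(z) = -(z_0 + ⋯ + z_{k - λ'_k - 1})` for `k > ℓ(λ)`. -/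
noncomputable def xBz (l : ℕ → ℕ) (z : ℕ → ℝ) (k : ℕ) : ℝ :=
  if k ≤ spLength l then ∑ t ∈ Finset.range (l k), z t
  else -∑ t ∈ Finset.range (k - colB l k), z t


theorem sp_step {l : ℕ → ℕ} (hl : IsStrictPartition l) {i : ℕ} (hi : 1 ≤ i) :
    l (i + 1) < l i ∨ (l i = 0 ∧ l (i + 1) = 0) := by
  have := hl.2 i hi
  by_cases h : l i = 0
  · exact Or.inr ⟨h, this.1 h⟩
  · exact Or.inl (this.2 h)

theorem sp_lt {l : ℕ → ℕ} (hl : IsStrictPartition l) {i j : ℕ} (hi : 1 ≤ i) (hij : i < j) :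
    l j + j ≤ l i + i ∧ l j < l i ∨ l j = 0 := by
  induction j, hij using Nat.le_induction with
  | base => have := sp_step hl hi; simp only [Nat.succ_eq_add_one]; omega
  | succ j hj ih =>
    have := sp_step hl (i := j) (by omega)
    omega

theorem sp_le {l : ℕ → ℕ} (hl : IsStrictPartition l) {i j : ℕ} (hi : 1 ≤ i) (hij : i ≤ j) :
    l j + j ≤ l i + i ∨ l j = 0 := by
  rcases Nat.eq_or_lt_of_le hij with h | h
  · subst h; left; omega
  · have := sp_lt hl hi h; omega

theorem sp_inj {l : ℕ → ℕ} (hl : IsStrictPartition l) {i j : ℕ} (hi : 1 ≤ i) (hj : 1 ≤ j)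
    (h : l i = l j) (h0 : l i ≠ 0) : i = j := by
  rcases Nat.lt_trichotomy i j with h1 | h1 | h1
  · have := sp_lt hl hi h1; omega
  · exact h1
  · have := sp_lt hl hj h1; omega

theorem sp_of {l : ℕ → ℕ} (h0 : l 0 = 0)
    (h : ∀ i, 1 ≤ i → l (i + 1) < l i ∨ (l i = 0 ∧ l (i + 1) = 0)) : IsStrictPartition l :=
  ⟨h0, fun i hi => by have := h i hi; omega⟩

theorem mem_cD {l : ℕ → ℕ} (hl : IsStrictPartition l) (p : ℕ × ℕ) :
    p ∈ cellsD l ↔ 1 ≤ p.1 ∧ p.1 < p.2 ∧ p.2 ≤ l p.1 + p.1 := by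
  simp only [cellsD, Finset.mem_filter, Finset.mem_product, Finset.mem_Icc]
  constructor
  · rintro ⟨⟨⟨a, b⟩, c, d⟩, e, f⟩; exact ⟨a, e, f⟩
  · rintro ⟨a, b, c⟩
    have := sp_le hl (le_refl 1) a
    omega

theorem ideal_cD {l : ℕ → ℕ} (hl : IsStrictPartition l) {i j i' j' : ℕ}
    (h : (i', j') ∈ cellsD l) (h1 : 1 ≤ i) (h2 : i ≤ i') (h3 : i < j) (h4 : j ≤ j') :
    (i, j) ∈ cellsD l := by
  rw [mem_cD hl] at *
  have := sp_le hl h1 h2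
  simp only at *
  omega

def incR (m : ℕ → ℕ) (k : ℕ) : ℕ → ℕ := fun i => if i = k then m i + 1 else m i
def decR (m : ℕ → ℕ) (k : ℕ) : ℕ → ℕ := fun i => if i = k then m i - 1 else m i

theorem sp_dec {m : ℕ → ℕ} (hm : IsStrictPartition m) {k : ℕ} (hk : 1 ≤ k)
    (h : m (k + 1) + 1 < m k ∨ m k = 1) : IsStrictPartition (decR m k) := by
  refine sp_of (by simp [decR, hm.1]) fun i hi => ?_
  have := sp_step hm hi
  simp only [decR]
  by_cases h1 : i = k
  · subst h1; simp; omega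
  · by_cases h2 : i + 1 = k
    · subst h2; simp; omega
    · simp [h1, h2]; omega

theorem dec_sp {m : ℕ → ℕ} {k : ℕ} (hk : 1 ≤ k) (h0 : m k ≠ 0)
    (h : IsStrictPartition (decR m k)) : m (k + 1) + 1 < m k ∨ m k = 1 := by
  have := sp_step h hk
  simp [decR] at this
  omega

theorem sp_inc {m : ℕ → ℕ} (hm : IsStrictPartition m) {k : ℕ} (hk : 1 ≤ k)
    (h : k = 1 ∨ m k + 1 < m (k - 1)) : IsStrictPartition (incR m k) := by
  refine sp_of (by simp [incR, hm.1]; omega) fun i hi => ?_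
  have := sp_step hm hi
  simp only [incR]
  by_cases h1 : i = k
  · subst h1; simp; omega
  · by_cases h2 : i + 1 = k
    · subst h2; simp at *; omega
    · simp [h1, h2]; omega

theorem inc_sp {m : ℕ → ℕ} {k : ℕ} (hk : 1 ≤ k)
    (h : IsStrictPartition (incR m k)) : k = 1 ∨ m k + 1 < m (k - 1) := by
  by_cases h1 : k = 1
  · exact Or.inl h1
  · right
    obtain ⟨j, rfl⟩ : ∃ j, k = j + 1 := ⟨k - 1, by omega⟩
    have := sp_step h (i := j) (by omega)
    simp [incR] at this ⊢
    omega

theorem cD_dec {m : ℕ → ℕ} (hm : IsStrictPartition m) {k : ℕ} (hk : 1 ≤ k) (h0 : m k ≠ 0)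
    (h : IsStrictPartition (decR m k)) : cellsD (decR m k) = (cellsD m).erase (k, m k + k) := by
  ext ⟨i, j⟩
  simp only [Finset.mem_erase, mem_cD hm, mem_cD h, decR, ne_eq, Prod.mk.injEq]
  by_cases h1 : i = k
  · subst h1; simp; omega
  · simp [h1]

theorem dec_inc (m : ℕ → ℕ) (k : ℕ) : decR (incR m k) k = m := by
  funext i; simp only [decR, incR]; split <;> simp
theorem inc_dec {m : ℕ → ℕ} {k : ℕ} (h : m k ≠ 0) : incR (decR m k) k = m := by
  funext i; simp only [decR, incR]; split
  · subst i; omega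
  · rfl
theorem dec_inc_comm (m : ℕ → ℕ) {k i : ℕ} (h : i ≠ k) :
    decR (incR m i) k = incR (decR m k) i := by
  funext j; simp only [decR, incR]
  by_cases h1 : j = k
  · subst h1; simp [Ne.symm h]
  · simp [h1]

/-- backward closure -/
theorem move_back {l : ℕ → ℕ} (hl : IsStrictPartition l) {D D' : Finset (ℕ × ℕ)}
    (h : ExcitedMoveD l D D') (hD : D' ⊆ cellsD l) : D ⊆ cellsD l := by
  rcases h with ⟨i, j, hij, h1, h2, -, h3, -, h4, -, rfl⟩ |
    ⟨i, h1, h2, -, h3, -, h4, -, h5, -, h6, -, rfl⟩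
  · intro p hp
    by_cases hpq : p = (i, j)
    · subst hpq
      have := (mem_cD hl _).1 h3
      exact ideal_cD hl h4 this.1 (by omega) (by omega) (by omega)
    · exact hD (by simp [hp, hpq])
  · intro p hp
    by_cases hpq : p = (i, i + 1)
    · subst hpq
      have := (mem_cD hl _).1 h2
      exact ideal_cD hl h2 this.1 (by omega) (by omega) (by omega)
    · exact hD (by simp [hp, hpq])

theorem reach_back {l : ℕ → ℕ} (hl : IsStrictPartition l) {D D' : Finset (ℕ × ℕ)}
    (h : Relation.ReflTransGen (ExcitedMoveD l) D D') (hD : D' ⊆ cellsD l) : D ⊆ cellsD l := by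
  induction h with
  | refl => exact hD
  | tail _ h2 ih => exact ih (move_back hl h2 hD)

theorem move_mono {l l' : ℕ → ℕ} (hll : cellsD l' ⊆ cellsD l) {D D' : Finset (ℕ × ℕ)}
    (h : ExcitedMoveD l' D D') : ExcitedMoveD l D D' := by
  rcases h with ⟨i, j, hij, h1, h2, g2, h3, g3, h4, g4, e⟩ |
    ⟨i, h1, h2, g2, h3, g3, h4, g4, h5, g5, h6, g6, e⟩
  · exact Or.inl ⟨i, j, hij, h1, hll h2, g2, hll h3, g3, hll h4, g4, e⟩
  · exact Or.inr ⟨i, h1, hll h2, g2, hll h3, g3, hll h4, g4, hll h5, g5, hll h6, g6, e⟩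
theorem inv0 {l : ℕ → ℕ} {a : ℕ} {D D' : Finset (ℕ × ℕ)} (h : ExcitedMoveD l D D')
    (hD : ∀ p ∈ D, p.2 ≠ p.1 + a) : ∀ p ∈ D', p.2 ≠ p.1 + a := by
  rcases h with ⟨i, j, hij, h1, -, -, -, -, -, -, rfl⟩ |
    ⟨i, h1, -, -, -, -, -, -, -, -, -, -, rfl⟩
  all_goals
    intro p hp
    rw [Finset.mem_insert, Finset.mem_erase] at hp
    rcases hp with rfl | hp
    · have := hD _ h1
      simp only at *; omega
    · exact hD _ hp.2

theorem invJ {l : ℕ → ℕ} {a : ℕ} (ha : 1 ≤ a) {D D' : Finset (ℕ × ℕ)} (h : ExcitedMoveD l D D')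
    (hD : ∃ p ∈ D, p.2 = p.1 + a + 1 ∧ ∀ q ∈ D, q.2 = q.1 + a → q.1 ≤ p.1) :
    ∃ p ∈ D', p.2 = p.1 + a + 1 ∧ ∀ q ∈ D', q.2 = q.1 + a → q.1 ≤ p.1 := by
  obtain ⟨⟨p1, p2⟩, hp, hp2, hq⟩ := hD
  simp only at hp2
  subst hp2
  rcases h with ⟨i, j, hij, h1, -, g2, -, g3, -, g4, rfl⟩ |
    ⟨i, h1, -, g2, -, g3, -, g4, -, g5, -, g6, rfl⟩
  · by_cases hpi : (p1, p1 + a + 1) = (i, j)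
    · simp only [Prod.mk.injEq] at hpi
      refine ⟨(i + 1, j + 1), by simp, by simp only; omega, ?_⟩
      intro q hq' hqa
      rw [Finset.mem_insert, Finset.mem_erase] at hq'
      rcases hq' with rfl | hq'
      · simp only at *; omega
      · have := hq q hq'.2 hqa
        simp only at *; omega
    · refine ⟨(p1, p1 + a + 1), by simp [hp]; exact Or.inr (by simpa using hpi), rfl, ?_⟩
      intro q hq' hqa
      rw [Finset.mem_insert, Finset.mem_erase] at hq'
      rcases hq' with rfl | hq'
      · have := hq _ h1 (by simp only at *; omega)
        simp only at *
        by_contra hc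
        have e : p1 = i := by omega
        subst e
        apply g3
        have : j + 1 = p1 + a + 1 := by omega
        rw [this]; exact hp
      · exact hq q hq'.2 hqa
  · have hpi : (p1, p1 + a + 1) ≠ (i, i + 1) := by simp only [ne_eq, Prod.mk.injEq]; omega
    refine ⟨(p1, p1 + a + 1), by simp [hp]; exact Or.inr (by simpa using hpi), rfl, ?_⟩
    intro q hq' hqa
    rw [Finset.mem_insert, Finset.mem_erase] at hq'
    rcases hq' with rfl | hq'
    · have := hq _ h1 (by simp only at *; omega)
      simp only at *
      have ea : a = 1 := by omega
      subst ea
      by_contra hc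
      have e : p1 = i ∨ p1 = i + 1 := by omega
      rcases e with rfl | rfl
      · exact g2 hp
      · exact g5 hp
    · exact hq q hq'.2 hqa

theorem invJ' {l : ℕ → ℕ} {a : ℕ} (ha : 2 ≤ a) {D D' : Finset (ℕ × ℕ)} (h : ExcitedMoveD l D D')
    (hD : ∃ p ∈ D, p.2 + 1 = p.1 + a ∧ ∀ q ∈ D, q.2 = q.1 + a → q.1 + 1 ≤ p.1) :
    ∃ p ∈ D', p.2 + 1 = p.1 + a ∧ ∀ q ∈ D', q.2 = q.1 + a → q.1 + 1 ≤ p.1 := by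
  obtain ⟨⟨p1, p2⟩, hp, hp2, hq⟩ := hD
  simp only at hp2
  rcases h with ⟨i, j, hij, h1, -, g2, -, g3, -, g4, rfl⟩ |
    ⟨i, h1, -, g2, -, g3, -, g4, -, g5, -, g6, rfl⟩
  · by_cases hpi : (p1, p2) = (i, j)
    · simp only [Prod.mk.injEq] at hpi
      refine ⟨(i + 1, j + 1), by simp, by simp only; omega, ?_⟩
      intro q hq' hqa
      rw [Finset.mem_insert, Finset.mem_erase] at hq'
      rcases hq' with rfl | hq'
      · simp only at *; omega
      · have := hq q hq'.2 hqa
        simp only at *; omega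
    · refine ⟨(p1, p2), by simp [hp]; exact Or.inr (by simpa using hpi), hp2, ?_⟩
      intro q hq' hqa
      rw [Finset.mem_insert, Finset.mem_erase] at hq'
      rcases hq' with rfl | hq'
      · have := hq _ h1 (by simp only at *; omega)
        simp only at *
        by_contra hc
        have e : p1 = i + 1 := by omega
        have e2 : p2 = j := by omega
        subst e; subst e2
        exact g2 hp
      · exact hq q hq'.2 hqa
  · by_cases hpi : (p1, p2) = (i, i + 1)
    · simp only [Prod.mk.injEq] at hpi
      refine ⟨(i + 2, i + 3), by simp, by simp only; omega, ?_⟩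
      intro q hq' hqa
      rw [Finset.mem_insert, Finset.mem_erase] at hq'
      rcases hq' with rfl | hq'
      · simp only at *; omega
      · have := hq q hq'.2 hqa
        simp only at *; omega
    · refine ⟨(p1, p2), by simp [hp]; exact Or.inr (by simpa using hpi), hp2, ?_⟩
      intro q hq' hqa
      rw [Finset.mem_insert, Finset.mem_erase] at hq'
      rcases hq' with rfl | hq'
      · simp only at *; omega
      · exact hq q hq'.2 hqa

theorem erase_move {l : ℕ → ℕ} {D : Finset (ℕ × ℕ)} {q x y : ℕ × ℕ} (hy : y ∉ D) (hq : q ∈ D) :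
    (insert y (D.erase x)).erase q = insert y ((D.erase q).erase x) := by
  have : y ≠ q := fun h => hy (h ▸ hq)
  rw [Finset.erase_insert_of_ne this, Finset.erase_right_comm]

/-- a move of a cell other than `q` is still a move after deleting `q` -/
theorem move_erase {l : ℕ → ℕ} {D D' : Finset (ℕ × ℕ)} {q : ℕ × ℕ} (h : ExcitedMoveD l D D')
    (hq : q ∈ D) (hq' : q ∈ D') : ExcitedMoveD l (D.erase q) (D'.erase q) := by
  rcases h with ⟨i, j, hij, h1, f2, g2, f3, g3, f4, g4, rfl⟩ |
    ⟨i, h1, f2, g2, f3, g3, f4, g4, f5, g5, f6, g6, rfl⟩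
  · have hne : (i, j) ≠ q := by
      rintro rfl
      simp at hq'
    refine Or.inl ⟨i, j, hij, by simp [hne, h1], f2, ?_, f3, ?_, f4, ?_, erase_move (l := l) g4 hq⟩
      <;> simp only [Finset.mem_erase, not_and_of_not_right, g2, g3, g4, not_false_eq_true, and_false]
  · have hne : (i, i + 1) ≠ q := by
      rintro rfl
      simp at hq'
    refine Or.inr ⟨i, by simp [hne, h1], f2, ?_, f3, ?_, f4, ?_, f5, ?_, f6, ?_,
      erase_move (l := l) g6 hq⟩
      <;> simp only [Finset.mem_erase, g2, g3, g4, g5, g6, not_false_eq_true, and_false]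

theorem invI {l : ℕ → ℕ} {a k : ℕ} {M : Finset (ℕ × ℕ)} {D D' : Finset (ℕ × ℕ)}
    (h : ExcitedMoveD l D D')
    (hD : ∃ q ∈ D, q.2 = q.1 + a ∧ (a = 1 → q.1 % 2 = k % 2) ∧
      (∀ p ∈ D, p.2 = p.1 + a → p.1 ≤ q.1) ∧
      Relation.ReflTransGen (ExcitedMoveD l) M (D.erase q)) :
    ∃ q ∈ D', q.2 = q.1 + a ∧ (a = 1 → q.1 % 2 = k % 2) ∧
      (∀ p ∈ D', p.2 = p.1 + a → p.1 ≤ q.1) ∧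
      Relation.ReflTransGen (ExcitedMoveD l) M (D'.erase q) := by
  obtain ⟨⟨q1, q2⟩, hq, hq2, hk, hmax, hr⟩ := hD
  simp only at hq2 hk hmax
  by_cases hqD : (q1, q2) ∈ D'
  · refine ⟨(q1, q2), hqD, hq2, hk, ?_, hr.tail (move_erase h hq hqD)⟩
    intro p hp hpa
    rcases h with ⟨i, j, hij, h1, f2, g2, f3, g3, f4, g4, rfl⟩ |
      ⟨i, h1, f2, g2, f3, g3, f4, g4, f5, g5, f6, g6, rfl⟩
    · rw [Finset.mem_insert, Finset.mem_erase] at hp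
      rcases hp with rfl | hp
      · have := hmax _ h1 (by simp only at *; omega)
        simp only at *
        by_contra hc
        have e : q1 = i := by omega
        subst e
        have e : q2 = j := by omega
        subst e
        simp at hqD
      · exact hmax p hp.2 hpa
    · rw [Finset.mem_insert, Finset.mem_erase] at hp
      rcases hp with rfl | hp
      · have := hmax _ h1 (by simp only at *; omega)
        simp only at *
        have ea : a = 1 := by omega
        subst ea
        subst hq2
        by_contra hc
        have e : q1 = i ∨ q1 = i + 1 := by omega
        rcases e with rfl | rfl
        · simp at hqD
        · exact g4 hq
      · exact hmax p hp.2 hpa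
  · rcases h with ⟨i, j, hij, h1, f2, g2, f3, g3, f4, g4, rfl⟩ |
      ⟨i, h1, f2, g2, f3, g3, f4, g4, f5, g5, f6, g6, rfl⟩
    · have e : (q1, q2) = (i, j) := by
        by_contra hne
        exact hqD (by rw [Finset.mem_insert, Finset.mem_erase]; exact Or.inr ⟨hne, hq⟩)
      simp only [Prod.mk.injEq] at e
      obtain ⟨rfl, rfl⟩ := e
      refine ⟨(q1 + 1, q2 + 1), by simp, by simp only; omega, fun ha => by omega, ?_, ?_⟩
      · intro p hp hpa
        rw [Finset.mem_insert, Finset.mem_erase] at hp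
        rcases hp with rfl | hp
        · exact le_refl _
        · have := hmax p hp.2 hpa
          simp only; omega
      · rw [Finset.erase_insert]
        · exact hr
        · simp [g4]
    · have e : (q1, q2) = (i, i + 1) := by
        by_contra hne
        exact hqD (by rw [Finset.mem_insert, Finset.mem_erase]; exact Or.inr ⟨hne, hq⟩)
      simp only [Prod.mk.injEq] at e
      obtain ⟨rfl, rfl⟩ := e
      refine ⟨(q1 + 2, q1 + 3), by simp, by simp only; omega, fun ha => ?_, ?_, ?_⟩
      · have := hk ha
        simp only; omega
      · intro p hp hpa
        rw [Finset.mem_insert, Finset.mem_erase] at hp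
        rcases hp with rfl | hp
        · exact le_refl _
        · have := hmax p hp.2 hpa
          simp only; omega
      · rw [Finset.erase_insert]
        · exact hr
        · simp [g6]

theorem reach_inv {l : ℕ → ℕ} {P : Finset (ℕ × ℕ) → Prop}
    (hP : ∀ D D', ExcitedMoveD l D D' → P D → P D') {D D' : Finset (ℕ × ℕ)}
    (h : Relation.ReflTransGen (ExcitedMoveD l) D D') (hD : P D) : P D' := by
  induction h with
  | refl => exact hD
  | tail _ h2 ih => exact hP _ _ h2 ih
def RemB (a r : ℕ) (m : ℕ → ℕ) (k : ℕ) : Prop :=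
  1 ≤ k ∧ m k = a ∧ IsStrictPartition (decR m k) ∧ (a = 1 → k % 2 = r % 2)

theorem last_dec {l : ℕ → ℕ} (hl : IsStrictPartition l) {r : ℕ} (hr : 1 ≤ r) (h0 : l r ≠ 0)
    (h1 : l (r + 1) = 0) : IsStrictPartition (decR l r) :=
  sp_dec hl hr (by omega)

theorem last_zero {l : ℕ → ℕ} (hl : IsStrictPartition l) {r : ℕ} (hr : 1 ≤ r)
    (h1 : l (r + 1) = 0) {i : ℕ} (hi : r < i) : l i = 0 := by
  have := sp_le hl (i := r + 1) (j := i) (by omega) hi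
  omega

theorem crux_extract {l : ℕ → ℕ} (hl : IsStrictPartition l) {r : ℕ} (hr : 1 ≤ r) (h0 : l r ≠ 0)
    (h1 : l (r + 1) = 0) {D D' : Finset (ℕ × ℕ)} (hD : D ⊆ cellsD (decR l r))
    (hmv : ExcitedMoveD l D D') (hu : (r, l r + r) ∈ D') (hu' : (r, l r + r) ∉ D) :
    ∃ q ∈ D, q.2 = q.1 + l r ∧ D'.erase (r, l r + r) = D.erase q ∧
      (l r = 1 → q.1 % 2 = r % 2) ∧
      (∀ p ∈ D, p.2 = p.1 + l r → p.1 ≤ q.1) ∧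
      (∀ p ∈ D, p.2 = p.1 + l r + 1 → p.1 < q.1) ∧
      (2 ≤ l r → ∀ p ∈ D, p.2 + 1 = p.1 + l r → p.1 ≤ q.1) := by
  have hl' := last_dec hl hr h0 h1
  have key : ∀ p ∈ D, (1 ≤ p.1 ∧ p.1 < p.2) ∧
      (p.1 < r ∨ (p.1 = r ∧ p.2 + 1 ≤ l r + r)) := by
    intro p hp
    have h := (mem_cD hl' p).1 (hD hp)
    refine ⟨⟨h.1, h.2.1⟩, ?_⟩
    have hz : r < p.1 → l p.1 = 0 := fun h => last_zero hl hr h1 h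
    simp only [decR] at h
    by_cases hpr : p.1 = r
    · rw [if_pos hpr, hpr] at h; omega
    · rw [if_neg hpr] at h; omega
  have mem : ∀ p ∈ D, ∀ x y, p.1 = x → p.2 = y → (x, y) ∈ D := by
    rintro ⟨p1, p2⟩ hp x y rfl rfl; exact hp
  rcases hmv with ⟨i, j, hij, h1, f2, g2, f3, g3, f4, g4, rfl⟩ |
      ⟨i, h1, f2, g2, f3, g3, f4, g4, f5, g5, f6, g6, rfl⟩
  · rw [Finset.mem_insert, Finset.mem_erase] at hu
    have e : (r, l r + r) = (i + 1, j + 1) := by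
      rcases hu with h | h
      · exact h
      · exact absurd h.2 hu'
    rw [e]
    simp only [Prod.mk.injEq] at e
    refine ⟨(i, j), h1, by simp only; omega, ?_, fun h => by omega, ?_, ?_, ?_⟩
    · rw [Finset.erase_insert]; simp [g4]
    · intro p hp hpa
      have := key p hp
      simp only; omega
    · intro p hp hpa
      have := key p hp
      simp only
      by_contra hc
      exact g3 (mem p hp _ _ (by omega) (by omega))
    · intro _ p hp hpa
      have := key p hp
      simp only
      by_contra hc
      exact g2 (mem p hp _ _ (by omega) (by omega))
  · rw [Finset.mem_insert, Finset.mem_erase] at hu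
    have e : (r, l r + r) = (i + 2, i + 3) := by
      rcases hu with h | h
      · exact h
      · exact absurd h.2 hu'
    rw [e]
    simp only [Prod.mk.injEq] at e
    refine ⟨(i, i + 1), h1, by simp only; omega, ?_, fun h => by simp only; omega, ?_, ?_, ?_⟩
    · rw [Finset.erase_insert]; simp [g6]
    · intro p hp hpa
      have := key p hp
      simp only
      by_contra hc
      exact g4 (mem p hp _ _ (by omega) (by omega))
    · intro p hp hpa
      have := key p hp
      simp only
      by_contra hc
      have : p.1 = i ∨ p.1 = i + 1 := by omega
      rcases this with h | h
      · exact g2 (mem p hp _ _ (by omega) (by omega))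
      · exact g5 (mem p hp _ _ (by omega) (by omega))
    · intro h; omega

theorem threshold {m : ℕ → ℕ} (hm : IsStrictPartition m) {a : ℕ} (ha : 1 ≤ a) :
    ∃ k, (∀ i, 1 ≤ i → i ≤ k → a ≤ m i) ∧ ∀ i, k < i → m i < a := by
  have hex : ∃ k, m (k + 1) < a := by
    refine ⟨m 1 + 1, ?_⟩
    have := sp_le hm (le_refl 1) (j := m 1 + 1 + 1) (by omega)
    omega
  classical
  refine ⟨Nat.find hex, fun i h1 h2 => ?_, fun i hi => ?_⟩
  · have := Nat.find_min hex (m := i - 1) (by omega)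
    rw [Nat.sub_add_cancel h1] at this
    omega
  · have h := Nat.find_spec hex
    have := sp_le hm (i := Nat.find hex + 1) (j := i) (by omega) hi
    omega

theorem crux {l m : ℕ → ℕ} (hl : IsStrictPartition l) (hm : IsStrictPartition m)
    {r : ℕ} (hr : 1 ≤ r) (h0 : l r ≠ 0)
    (h1 : l (r + 1) = 0) {D D' : Finset (ℕ × ℕ)} (hD : D ⊆ cellsD (decR l r))
    (hreach : Relation.ReflTransGen (ExcitedMoveD (decR l r)) (cellsD m) D)
    (hmv : ExcitedMoveD l D D') (hu : (r, l r + r) ∈ D') (hu' : (r, l r + r) ∉ D) :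
    ∃ k, RemB (l r) r m k ∧
      Relation.ReflTransGen (ExcitedMoveD (decR l r)) (cellsD (decR m k))
        (D'.erase (r, l r + r)) := by
  obtain ⟨q, hq, hqa, hE, hpar, hA, hB, hC⟩ := crux_extract hl hr h0 h1 hD hmv hu hu'
  obtain ⟨k, hk1, hk2⟩ := threshold hm (a := l r) (by omega)
  rw [hE]
  by_cases hk : k = 0
  · exfalso
    refine reach_inv (P := fun D => ∀ p ∈ D, p.2 ≠ p.1 + l r) (fun D D' h => inv0 h) hreach ?_
      q hq hqa
    intro p hp hpa
    have h := (mem_cD hm p).1 hp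
    have := hk2 p.1 (by omega)
    omega
  have hmk := hk1 k (by omega) (le_refl _)
  have hmk1 := hk2 (k + 1) (by omega)
  have diag : ∀ q ∈ cellsD m, q.2 = q.1 + l r → q.1 ≤ k := by
    intro q hq hqa
    have h := (mem_cD hm q).1 hq
    by_contra hc
    have := hk2 q.1 (by omega)
    omega
  by_cases hgt : l r < m k
  · exfalso
    obtain ⟨p, hp, hp2, hp3⟩ := reach_inv
      (P := fun D => ∃ p ∈ D, p.2 = p.1 + l r + 1 ∧ ∀ q ∈ D, q.2 = q.1 + l r → q.1 ≤ p.1)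
      (fun D D' h => invJ (by omega) h) hreach
      ⟨(k, k + l r + 1), by rw [mem_cD hm]; simp only; omega, rfl, diag⟩
    have h2 := hB p hp hp2
    have h3 := hp3 q hq hqa
    omega
  by_cases hadj : 2 ≤ l r ∧ m (k + 1) + 1 = l r
  · exfalso
    obtain ⟨p, hp, hp2, hp3⟩ := reach_inv
      (P := fun D => ∃ p ∈ D, p.2 + 1 = p.1 + l r ∧ ∀ q ∈ D, q.2 = q.1 + l r → q.1 + 1 ≤ p.1)
      (fun D D' h => invJ' hadj.1 h) hreach
      ⟨(k + 1, k + l r), by rw [mem_cD hm]; simp only; omega, by simp only; omega,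
        fun q hq hqa => by have := diag q hq hqa; simp only; omega⟩
    have h2 := hC hadj.1 p hp hp2
    have h3 := hp3 q hq hqa
    omega
  have hdec : IsStrictPartition (decR m k) := sp_dec hm (by omega) (by omega)
  obtain ⟨p, hp, hp2, hppar, hpmax, hpr⟩ := reach_inv
    (P := fun D => ∃ q ∈ D, q.2 = q.1 + l r ∧ (l r = 1 → q.1 % 2 = k % 2) ∧
      (∀ p ∈ D, p.2 = p.1 + l r → p.1 ≤ q.1) ∧
      Relation.ReflTransGen (ExcitedMoveD (decR l r)) (cellsD (decR m k)) (D.erase q))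
    (fun D D' h => invI h) hreach
    ⟨(k, m k + k), by rw [mem_cD hm]; simp only; omega, by simp only; omega, fun _ => rfl, diag, by
      rw [cD_dec hm (by omega) (by omega) hdec]⟩
  have h2 := hA p hp hp2
  have h3 := hpmax q hq hqa
  have hpq : p = q := Prod.ext (by omega) (by omega)
  subst hpq
  exact ⟨k, ⟨by omega, by omega, hdec, fun h => by rw [← hppar h, hpar h]⟩, hpr⟩

theorem move_cases {l : ℕ → ℕ} (hl : IsStrictPartition l) {r : ℕ} (hr : 1 ≤ r) (h0 : l r ≠ 0)
    (h1 : l (r + 1) = 0) {D D' : Finset (ℕ × ℕ)} (hmv : ExcitedMoveD l D D')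
    (hu : (r, l r + r) ∈ D ∨ (r, l r + r) ∉ D') :
    ((r, l r + r) ∈ D → (r, l r + r) ∈ D') ∧ ExcitedMoveD (decR l r) (D.erase (r, l r + r)) (D'.erase (r, l r + r)) := by
  have hl' := last_dec hl hr h0 h1
  have hc := cD_dec hl hr h0 hl'
  have hne : ∀ i j, (i, j + 1) ∈ cellsD l → (i, j) ≠ (r, l r + r) := by
    intro i j hij e
    have := (mem_cD hl _).1 hij
    simp only [Prod.mk.injEq] at e this
    obtain ⟨rfl, rfl⟩ := e
    omega
  set u := (r, l r + r) with hu_def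
  rcases hmv with ⟨i, j, hij, h1, f2, g2, f3, g3, f4, g4, rfl⟩ |
      ⟨i, h1, f2, g2, f3, g3, f4, g4, f5, g5, f6, g6, rfl⟩
  · have n1 : (i, j) ≠ u := hne _ _ f3
    have n4 : (i + 1, j + 1) ≠ u := by
      rintro e
      rcases hu with hu | hu
      · exact g4 (e ▸ hu)
      · apply hu; rw [e]; simp
    have n2 : (i + 1, j) ≠ u := hne _ _ f4
    have n3 : (i, j + 1) ≠ u := by
      intro e
      have a1 := (mem_cD hl _).1 f4
      have a2 := last_zero hl hr ‹l (r + 1) = 0› (i := i + 1)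
        (by simp only [hu_def, Prod.mk.injEq] at e; omega)
      simp only at a1; omega
    refine ⟨fun h => by simp [h, Ne.symm n1], Or.inl ⟨i, j, hij, ?_⟩⟩
    simp only [hc, Finset.mem_erase]
    refine ⟨⟨n1, h1⟩, ⟨n2, f2⟩, fun h => g2 h.2, ⟨n3, f3⟩, fun h => g3 h.2, ⟨n4, f4⟩,
      fun h => g4 h.2, ?_⟩
    rw [Finset.erase_insert_of_ne n4, Finset.erase_right_comm]
  · have n1 : (i, i + 1) ≠ u := hne _ _ f2
    have n4 : (i + 2, i + 3) ≠ u := by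
      rintro e
      rcases hu with hu | hu
      · exact g6 (e ▸ hu)
      · apply hu; rw [e]; simp
    have lt : i + 1 < r := by
      have a1 := (mem_cD hl _).1 f6
      by_contra hc
      have a2 := last_zero hl hr ‹l (r + 1) = 0› (i := i + 2) (by omega)
      simp only at a1; omega
    have n : ∀ x y, x < r → (x, y) ≠ u := by
      intro x y hx e
      simp only [hu_def, Prod.mk.injEq] at e; omega
    refine ⟨fun h => by simp [h, Ne.symm n1], Or.inr ⟨i, ?_⟩⟩
    simp only [hc, Finset.mem_erase]
    refine ⟨⟨n1, h1⟩, ⟨n _ _ (by omega), f2⟩, fun h => g2 h.2, ⟨n _ _ (by omega), f3⟩,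
      fun h => g3 h.2, ⟨n _ _ (by omega), f4⟩, fun h => g4 h.2, ⟨n _ _ (by omega), f5⟩,
      fun h => g5 h.2, ⟨n4, f6⟩, fun h => g6 h.2, ?_⟩
    rw [Finset.erase_insert_of_ne n4, Finset.erase_right_comm]

theorem decomp_fwd {l m : ℕ → ℕ} (hl : IsStrictPartition l) (hm : IsStrictPartition m)
    {r : ℕ} (hr : 1 ≤ r) (h0 : l r ≠ 0) (h1 : l (r + 1) = 0) {D : Finset (ℕ × ℕ)}
    (hreach : Relation.ReflTransGen (ExcitedMoveD l) (cellsD m) D) (hD : D ⊆ cellsD l) :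
    ((r, l r + r) ∉ D ∧ Relation.ReflTransGen (ExcitedMoveD (decR l r)) (cellsD m) D) ∨
    ((r, l r + r) ∈ D ∧ ∃ k, RemB (l r) r m k ∧
      Relation.ReflTransGen (ExcitedMoveD (decR l r)) (cellsD (decR m k))
        (D.erase (r, l r + r))) := by
  have hl' := last_dec hl hr h0 h1
  have hc := cD_dec hl hr h0 hl'
  induction hreach with
  | refl =>
    by_cases hu : (r, l r + r) ∈ cellsD m
    · right
      refine ⟨hu, r, ?_⟩
      have e1 := (mem_cD hm _).1 hu
      simp only at e1
      have e2 : m r ≤ l r := by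
        have := (mem_cD hl _).1 (hD ((mem_cD hm (r, m r + r)).2 (by simp only; omega)))
        simp only at this; omega
      have e3 : m (r + 1) = 0 := by
        by_contra hne
        have := (mem_cD hl _).1 (hD ((mem_cD hm (r + 1, r + 2)).2 (by simp only; omega)))
        simp only at this; omega
      have e4 : m r = l r := by omega
      have hd := last_dec hm hr (by omega) e3
      refine ⟨⟨hr, e4, hd, fun _ => rfl⟩, ?_⟩
      rw [cD_dec hm hr (by omega) hd, e4]
    · exact Or.inl ⟨hu, Relation.ReflTransGen.refl⟩
  | @tail D D' hDr hmv ih =>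
    have hDl := move_back hl hmv hD
    rcases ih hDl with ⟨hu, hR⟩ | ⟨hu, k, hk, hR⟩
    · by_cases hu' : (r, l r + r) ∈ D'
      · right
        refine ⟨hu', ?_⟩
        refine crux hl hm hr h0 h1 ?_ hR hmv hu' hu
        rw [hc]
        intro p hp
        rw [Finset.mem_erase]
        exact ⟨fun e => hu (e ▸ hp), hDl hp⟩
      · left
        have := (move_cases hl hr h0 h1 hmv (Or.inr hu')).2
        rw [Finset.erase_eq_of_notMem hu, Finset.erase_eq_of_notMem hu'] at this
        exact ⟨hu', hR.tail this⟩
    · right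
      have := move_cases hl hr h0 h1 hmv (Or.inl hu)
      exact ⟨this.1 hu, k, hk, hR.tail this.2⟩
theorem move_lift {l : ℕ → ℕ} (hl : IsStrictPartition l) {r : ℕ} (hr : 1 ≤ r) (h0 : l r ≠ 0)
    (h1 : l (r + 1) = 0) {D D' : Finset (ℕ × ℕ)} (hmv : ExcitedMoveD (decR l r) D D') :
    ExcitedMoveD l (insert (r, l r + r) D) (insert (r, l r + r) D') := by
  have hl' := last_dec hl hr h0 h1
  have hc := cD_dec hl hr h0 hl'
  have hne : ∀ i j, (i, j + 1) ∈ cellsD l → (i, j) ≠ (r, l r + r) := by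
    intro i j hij e
    have := (mem_cD hl _).1 hij
    simp only [Prod.mk.injEq] at e this
    obtain ⟨rfl, rfl⟩ := e
    omega
  set u := (r, l r + r) with hu_def
  rcases hmv with ⟨i, j, hij, h1, f2, g2, f3, g3, f4, g4, rfl⟩ |
      ⟨i, h1, f2, g2, f3, g3, f4, g4, f5, g5, f6, g6, rfl⟩
  · simp only [hc, Finset.mem_erase] at f2 f3 f4
    have n1 : (i, j) ≠ u := hne _ _ f3.2
    refine Or.inl ⟨i, j, hij, ?_⟩
    simp only [Finset.mem_insert]
    refine ⟨Or.inr h1, f2.2, ?_, f3.2, ?_, f4.2, ?_, ?_⟩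
    · exact fun h => h.elim f2.1 g2
    · exact fun h => h.elim f3.1 g3
    · exact fun h => h.elim f4.1 g4
    · rw [Finset.erase_insert_of_ne (Ne.symm n1), Finset.insert_comm]
  · simp only [hc, Finset.mem_erase] at f2 f3 f4 f5 f6
    have n1 : (i, i + 1) ≠ u := hne _ _ f2.2
    refine Or.inr ⟨i, ?_⟩
    simp only [Finset.mem_insert]
    refine ⟨Or.inr h1, f2.2, ?_, f3.2, ?_, f4.2, ?_, f5.2, ?_, f6.2, ?_, ?_⟩
    · exact fun h => h.elim f2.1 g2
    · exact fun h => h.elim f3.1 g3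
    · exact fun h => h.elim f4.1 g4
    · exact fun h => h.elim f5.1 g5
    · exact fun h => h.elim f6.1 g6
    · rw [Finset.erase_insert_of_ne (Ne.symm n1), Finset.insert_comm]

theorem slide {l n : ℕ → ℕ} (hl : IsStrictPartition l) (hn : IsStrictPartition n)
    {r k a : ℕ} (hr : 1 ≤ r) (hla : l r = a) (ha : 1 ≤ a)
    (hk : 1 ≤ k) (hna : n k + 1 = a) (hkr : k ≤ r) (hpar : a = 1 → k % 2 = r % 2) :
    Relation.ReflTransGen (ExcitedMoveD l) (insert (k, a + k) (cellsD n))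
      (insert (r, a + r) (cellsD n)) := by
  have hnz : ∀ s, k ≤ s → n s ≤ n k - (s - k) := by
    intro s hs
    have := sp_le hn hk hs
    omega
  have hlr : ∀ i, 1 ≤ i → i ≤ r → a + r ≤ l i + i := by
    intro i hi hir
    have := sp_le hl hi hir
    omega
  by_cases h2 : 2 ≤ a
  · clear hpar
    have : ∀ d, k + d ≤ r → Relation.ReflTransGen (ExcitedMoveD l)
        (insert (k, a + k) (cellsD n)) (insert (k + d, a + (k + d)) (cellsD n)) := by
      intro d
      induction d with
      | zero => intro _; exact Relation.ReflTransGen.refl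
      | succ d ih =>
        intro hd
        refine (ih (by omega)).tail (Or.inl ⟨k + d, a + (k + d), by omega, by simp, ?_⟩)
        have a1 := hnz (k + d) (by omega)
        have a2 := hnz (k + d + 1) (by omega)
        have b1 := hlr (k + d) (by omega) (by omega)
        have b2 := hlr (k + d + 1) (by omega) (by omega)
        simp only [Finset.mem_insert, mem_cD hl, mem_cD hn, Prod.mk.injEq]
        refine ⟨by omega, by omega, by omega, by omega, by omega, by omega, ?_⟩
        rw [Finset.erase_insert]
        · rfl
        · rw [mem_cD hn]; simp only; omega
    have := this (r - k) (by omega)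
    rwa [Nat.add_sub_cancel' hkr] at this
  · have ha1 : a = 1 := by omega
    subst ha1
    have hp := hpar rfl
    have : ∀ d, k + 2 * d ≤ r → Relation.ReflTransGen (ExcitedMoveD l)
        (insert (k, 1 + k) (cellsD n)) (insert (k + 2 * d, 1 + (k + 2 * d)) (cellsD n)) := by
      intro d
      induction d with
      | zero => intro _; exact Relation.ReflTransGen.refl
      | succ d ih =>
        intro hd
        refine (ih (by omega)).tail (Or.inr ⟨k + 2 * d, by
          rw [Nat.add_comm (k + 2 * d) 1]; simp, ?_⟩)
        have a1 := hnz (k + 2 * d) (by omega)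
        have a2 := hnz (k + 2 * d + 1) (by omega)
        have a3 := hnz (k + 2 * d + 2) (by omega)
        have b1 := hlr (k + 2 * d) (by omega) (by omega)
        have b2 := hlr (k + 2 * d + 1) (by omega) (by omega)
        have b3 := hlr (k + 2 * d + 2) (by omega) (by omega)
        simp only [Finset.mem_insert, mem_cD hl, mem_cD hn, Prod.mk.injEq]
        refine ⟨by omega, by omega, by omega, by omega, by omega, by omega, by omega, by omega,
          by omega, by omega, ?_⟩
        rw [Nat.add_comm (k + 2 * d) 1, Finset.erase_insert]
        · congr 2; omega
        · rw [mem_cD hn]; simp only; omega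
    have := this ((r - k) / 2) (by omega)
    rwa [show k + 2 * ((r - k) / 2) = r by omega] at this

theorem mem_ED {l m : ℕ → ℕ} {D : Finset (ℕ × ℕ)} : D ∈ ED l m ↔ D ⊆ cellsD l ∧
    Relation.ReflTransGen (ExcitedMoveD l) (cellsD m) D := by
  simp [ED]

theorem decomp_bwd {l m : ℕ → ℕ} (hl : IsStrictPartition l) (hm : IsStrictPartition m)
    {r : ℕ} (hr : 1 ≤ r) (h0 : l r ≠ 0) (h1 : l (r + 1) = 0) {k : ℕ} (hk : RemB (l r) r m k)
    {E : Finset (ℕ × ℕ)} (hE : E ∈ ED (decR l r) (decR m k)) :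
    insert (r, l r + r) E ∈ ED l m := by
  have hl' := last_dec hl hr h0 h1
  have hc := cD_dec hl hr h0 hl'
  obtain ⟨hk1, hmk, hd, hpar⟩ := hk
  rw [mem_ED] at *
  obtain ⟨hEs, hEr⟩ := hE
  have hsub := reach_back hl' hEr hEs
  have hll : cellsD (decR l r) ⊆ cellsD l := by rw [hc]; exact Finset.erase_subset _ _
  refine ⟨?_, ?_⟩
  · intro p hp
    rw [Finset.mem_insert] at hp
    rcases hp with rfl | hp
    · rw [mem_cD hl]; simp only; omega
    · exact hll (hEs hp)
  · have hkr : k ≤ r := by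
      by_contra hc
      have z1 := last_zero hl hr h1 (i := k) (by omega)
      by_cases h2 : 2 ≤ l r
      · have := (mem_cD hl _).1 (hll (hsub ((mem_cD hd (k, k + 1)).2
          (by simp only [decR, if_true]; omega))))
        simp only at this; omega
      · have hp := hpar (by omega)
        have z2 := last_zero hl hr h1 (i := k - 1) (by omega)
        have s := sp_lt hm (i := k - 1) (j := k) (by omega) (by omega)
        have := (mem_cD hl _).1 (hll (hsub ((mem_cD hd (k - 1, k)).2
          (by simp only [decR]; rw [if_neg (by omega)]; omega))))
        simp only at this; omega
    have s := slide hl hd hr rfl (by omega) hk1 (by simp only [decR, if_true]; omega) hkr hpar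
    have e : insert (k, l r + k) (cellsD (decR m k)) = cellsD m := by
      rw [cD_dec hm hk1 (by omega) hd, hmk, Finset.insert_erase]
      rw [mem_cD hm]; simp only; omega
    rw [e] at s
    refine s.trans ?_
    exact Relation.ReflTransGen.lift (fun D => insert (r, l r + r) D)
      (fun a b h => move_lift hl hr h0 h1 h) _ _ hEr

noncomputable def FF (x : ℕ → ℤ) (l m : ℕ → ℕ) : ℤ := ∑ D ∈ ED l m, ∏ p ∈ D, (x p.1 + x p.2)

theorem FF_norem {l m : ℕ → ℕ} (x : ℕ → ℤ) (hl : IsStrictPartition l) (hm : IsStrictPartition m)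
    {r : ℕ} (hr : 1 ≤ r) (h0 : l r ≠ 0) (h1 : l (r + 1) = 0) (hk : ∀ k, ¬ RemB (l r) r m k) :
    FF x l m = FF x (decR l r) m := by
  have hl' := last_dec hl hr h0 h1
  have hc := cD_dec hl hr h0 hl'
  have hll : cellsD (decR l r) ⊆ cellsD l := by rw [hc]; exact Finset.erase_subset _ _
  unfold FF
  congr 1
  ext D
  rw [mem_ED, mem_ED]
  constructor
  · rintro ⟨hD, hR⟩
    rcases decomp_fwd hl hm hr h0 h1 hR hD with ⟨h, h'⟩ | ⟨-, k, h, -⟩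
    · refine ⟨?_, h'⟩
      rw [hc, Finset.subset_erase]
      exact ⟨hD, h⟩
    · exact absurd h (hk k)
  · rintro ⟨hD, hR⟩
    exact ⟨hD.trans hll, Relation.ReflTransGen.mono (fun a b h => move_mono hll h) _ _ hR⟩

theorem RemB_unique {a r : ℕ} {m : ℕ → ℕ} (hm : IsStrictPartition m) (ha : a ≠ 0) {k k' : ℕ}
    (h : RemB a r m k) (h' : RemB a r m k') : k = k' :=
  sp_inj hm h.1 h'.1 (by rw [h.2.1, h'.2.1]) (by rw [h.2.1]; exact ha)

theorem FF_rem {l m : ℕ → ℕ} (x : ℕ → ℤ) (hl : IsStrictPartition l) (hm : IsStrictPartition m)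
    {r : ℕ} (hr : 1 ≤ r) (h0 : l r ≠ 0) (h1 : l (r + 1) = 0) {k : ℕ} (hk : RemB (l r) r m k) :
    FF x l m = FF x (decR l r) m + (x r + x (l r + r)) * FF x (decR l r) (decR m k) := by
  have hl' := last_dec hl hr h0 h1
  have hc := cD_dec hl hr h0 hl'
  have hll : cellsD (decR l r) ⊆ cellsD l := by rw [hc]; exact Finset.erase_subset _ _
  have hu : (r, l r + r) ∉ cellsD (decR l r) := by rw [hc]; simp
  have hset : ED l m = ED (decR l r) m ∪
      (ED (decR l r) (decR m k)).image (fun E => insert (r, l r + r) E) := by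
    ext D
    rw [Finset.mem_union, Finset.mem_image]
    constructor
    · intro h
      obtain ⟨hD, hR⟩ := mem_ED.1 h
      rcases decomp_fwd hl hm hr h0 h1 hR hD with ⟨h, h'⟩ | ⟨hu, k', h, h'⟩
      · left
        rw [mem_ED, hc, Finset.subset_erase]
        exact ⟨⟨hD, h⟩, h'⟩
      · right
        obtain rfl := RemB_unique hm h0 hk h
        refine ⟨D.erase (r, l r + r), ?_, Finset.insert_erase hu⟩
        rw [mem_ED, hc]
        exact ⟨Finset.erase_subset_erase _ hD, h'⟩
    · rintro (h | ⟨E, hE, rfl⟩)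
      · obtain ⟨hD, hR⟩ := mem_ED.1 h
        exact mem_ED.2 ⟨hD.trans hll, Relation.ReflTransGen.mono (fun a b h => move_mono hll h) _ _ hR⟩
      · exact decomp_bwd hl hm hr h0 h1 hk hE
  unfold FF
  rw [hset, Finset.sum_union, Finset.sum_image, Finset.mul_sum]
  · congr 1
    refine Finset.sum_congr rfl fun E hE => ?_
    rw [Finset.prod_insert fun h => hu ((mem_ED.1 hE).1 h)]
  · intro E hE E' hE' h
    simp only at h
    have e1 : (r, l r + r) ∉ E := fun h => hu ((mem_ED.1 hE).1 h)
    have e2 : (r, l r + r) ∉ E' := fun h => hu ((mem_ED.1 hE').1 h)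
    rw [← Finset.erase_insert e1, h, Finset.erase_insert e2]
  · rw [Finset.disjoint_left]
    intro D hD hD'
    rw [Finset.mem_image] at hD'
    obtain ⟨E, hE, rfl⟩ := hD'
    exact hu ((mem_ED.1 hD).1 (by simp))

theorem FF_zero {l m : ℕ → ℕ} (x : ℕ → ℤ) (hl : IsStrictPartition l)
    (h : ¬ cellsD m ⊆ cellsD l) : FF x l m = 0 := by
  unfold FF
  rw [Finset.sum_eq_zero]
  intro D hD
  rw [mem_ED] at hD
  exact absurd (reach_back hl hD.2 hD.1) h
noncomputable def sT (a r : ℕ) (t : ℕ → ℤ) : ℕ → ℤ := fun v =>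
  if a = 1 ∧ r % 2 = 1 then (if v = 0 then - t 1 else if v = 1 then - t 0 else t v)
  else (if v = a then t (a - 1) else if v + 1 = a then t a else t v)
noncomputable def alp (a r : ℕ) (t : ℕ → ℤ) : ℤ :=
  if a = 1 ∧ r % 2 = 1 then t 1 + t 0 else t a - t (a - 1)
noncomputable def del (a r : ℕ) (t : ℕ → ℤ) : ℤ :=
  if a = 1 ∧ r % 2 = 1 then t 1 + t 0 else 0
noncomputable def sgn (i : ℕ) : ℤ := if i % 2 = 1 then 1 else -1
noncomputable def cc (R : ℕ) (m : ℕ → ℕ) (t : ℕ → ℤ) : ℤ :=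
  ∑ i ∈ Finset.Icc 1 R, if m i = 0 then 0 else t (m i) + sgn i * t 0

def AddB (a r : ℕ) (m : ℕ → ℕ) (k : ℕ) : Prop :=
  1 ≤ k ∧ m k + 1 = a ∧ IsStrictPartition (incR m k) ∧ (a = 1 → k % 2 = r % 2)

theorem alp_sT {a r : ℕ} (ha : a ≠ 0) (t : ℕ → ℤ) : alp a r (sT a r t) = - alp a r t := by
  unfold alp sT
  by_cases h : a = 1 ∧ r % 2 = 1
  · simp [h]
  · have : a - 1 ≠ a := by omega
    have h2 : a - 1 + 1 = a := by omega
    simp [h, this, h2]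

theorem le_R {m : ℕ → ℕ} (hm : IsStrictPartition m) {R : ℕ} (hR : 1 ≤ R) (hmR : m R = 0) {i : ℕ}
    (h : m i ≠ 0) : i < R := by
  by_contra hc
  have := sp_le hm hR (j := i) (by omega)
  have e : i ≠ R := by rintro rfl; exact h hmR
  have := sp_lt hm hR (j := i) (by omega)
  omega

theorem cc_dec {R a r : ℕ} {m : ℕ → ℕ} (ha : a ≠ 0) {k : ℕ} (hk : RemB a r m k)
    (hkR : k ≤ R) (t : ℕ → ℤ) : cc R (decR m k) t = cc R m t - alp a r t := by
  obtain ⟨hk1, hmk, -, hpar⟩ := hk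
  have : cc R m t - cc R (decR m k) t = alp a r t := by
    unfold cc
    rw [← Finset.sum_sub_distrib, Finset.sum_eq_single k]
    · simp only [decR, hmk, if_true, alp, sgn]
      by_cases h1 : a = 1
      · subst h1
        have := hpar rfl
        rcases Nat.mod_two_eq_zero_or_one r with h | h <;> simp [this, h]; ring
      · have : a - 1 ≠ 0 := by omega
        simp [h1, ha, this]
    · intro b _ hb
      simp [decR, hb]
    · intro h; simp at h; omega
  linarith

theorem sum_pres {m : ℕ → ℕ} (hm : IsStrictPartition m) {R : ℕ} (hR : 1 ≤ R) (hmR : m R = 0)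
    {v : ℕ} (hv : v ≠ 0) (y : ℤ) :
    (∑ i ∈ Finset.Icc 1 R, if m i = v then y else 0) =
      if ∃ i, 1 ≤ i ∧ m i = v then y else 0 := by
  by_cases h : ∃ i, 1 ≤ i ∧ m i = v
  · rw [if_pos h]
    obtain ⟨i, hi, hiv⟩ := h
    rw [Finset.sum_eq_single i]
    · simp [hiv]
    · intro b hb hbi
      rw [if_neg]
      intro hbv
      exact hbi (sp_inj hm (Finset.mem_Icc.1 hb).1 hi (by omega) (by omega))
    · intro hn
      have := le_R hm hR hmR (i := i) (by omega)
      simp at hn; omega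
  · rw [if_neg h]
    refine Finset.sum_eq_zero fun i hi => ?_
    rw [if_neg]
    intro hiv
    exact h ⟨i, (Finset.mem_Icc.1 hi).1, hiv⟩

theorem sum_sgn (n : ℕ) : ∑ i ∈ Finset.Icc 1 n, sgn i = if n % 2 = 1 then 1 else 0 := by
  induction n with
  | zero => simp
  | succ n ih =>
    rw [Finset.sum_Icc_succ_top (by omega), ih]
    simp only [sgn]
    rcases Nat.mod_two_eq_zero_or_one n with h | h
    · have : (n + 1) % 2 = 1 := by omega
      simp [h, this]
    · have : (n + 1) % 2 = 0 := by omega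
      simp [h, this]

theorem sum_sgn' {m : ℕ → ℕ} {R : ℕ} (hR : 1 ≤ R) (hmR : m R = 0) {L : ℕ}
    (h1 : ∀ i, 1 ≤ i → i ≤ L → 1 ≤ m i) (h2 : ∀ i, L < i → m i < 1) :
    (∑ i ∈ Finset.Icc 1 R, if m i = 0 then 0 else sgn i) = if L % 2 = 1 then 1 else 0 := by
  rw [← sum_sgn]
  have hL : L ≤ R := by
    by_contra hc
    have := h1 R hR (by omega)
    omega
  rw [← Finset.sum_subset (Finset.Icc_subset_Icc_right hL)]
  · refine Finset.sum_congr rfl fun i hi => ?_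
    have := h1 i (Finset.mem_Icc.1 hi).1 (Finset.mem_Icc.1 hi).2
    rw [if_neg (by omega)]
  · intro i hi hi'
    rw [Finset.mem_Icc] at hi hi'
    have := h2 i (by omega)
    rw [if_pos (by omega)]

theorem cc_ge2 {m : ℕ → ℕ} (hm : IsStrictPartition m) {R : ℕ} (hR : 1 ≤ R) (hmR : m R = 0)
    {a r : ℕ} (ha : 2 ≤ a) (t : ℕ → ℤ) :
    cc R m t - cc R m (sT a r t) = (if ∃ i, 1 ≤ i ∧ m i = a then alp a r t else 0) +
      (if ∃ i, 1 ≤ i ∧ m i = a - 1 then - alp a r t else 0) := by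
  rw [← sum_pres hm hR hmR (by omega), ← sum_pres hm hR hmR (by omega), ← Finset.sum_add_distrib]
  unfold cc
  rw [← Finset.sum_sub_distrib]
  refine Finset.sum_congr rfl fun i _ => ?_
  have e1 : ¬ (a = 1 ∧ r % 2 = 1) := by omega
  have e2 : (0 : ℕ) ≠ a := by omega
  have e3 : 0 + 1 ≠ a := by omega
  have e4 : a ≠ a - 1 := by omega
  have e5 : a - 1 ≠ a := by omega
  have e6 : a - 1 + 1 = a := by omega
  have e7 : a - 1 ≠ 0 := by omega
  simp only [sT, alp, if_neg e1, if_neg e2, if_neg e3]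
  by_cases h0 : m i = 0
  · simp [h0, e2, Ne.symm e7]
  · by_cases h1 : m i = a
    · simp [h1, e4, Ne.symm e2]
    · by_cases h2 : m i = a - 1
      · simp [h2, e5, e6, e7]
      · have : m i + 1 ≠ a := by omega
        simp [h0, h1, h2, this]

theorem cc_one {m : ℕ → ℕ} (hm : IsStrictPartition m) {R : ℕ} (hR : 1 ≤ R) (hmR : m R = 0)
    {r : ℕ} {L : ℕ}
    (h1 : ∀ i, 1 ≤ i → i ≤ L → 1 ≤ m i) (h2 : ∀ i, L < i → m i < 1) (t : ℕ → ℤ) :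
    cc R m t - cc R m (sT 1 r t) = (if ∃ i, 1 ≤ i ∧ m i = 1 then alp 1 r t else 0) +
      (if L % 2 = 1 then 1 else 0) * (if r % 2 = 1 then alp 1 r t else - alp 1 r t) := by
  rw [← sum_pres hm hR hmR (by omega), ← sum_sgn' hR hmR h1 h2, Finset.sum_mul,
    ← Finset.sum_add_distrib]
  unfold cc
  rw [← Finset.sum_sub_distrib]
  refine Finset.sum_congr rfl fun i _ => ?_
  simp only [sT, alp]
  rcases Nat.mod_two_eq_zero_or_one r with h | h
  · by_cases h0 : m i = 0
    · simp [h0]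
    · by_cases h1 : m i = 1
      · simp [h1, h]; ring
      · simp [h0, h1, h]; ring
  · by_cases h0 : m i = 0
    · simp [h0]
    · by_cases h1 : m i = 1
      · simp [h1, h]; ring
      · simp [h0, h1, h]; ring

theorem rem_of {m : ℕ → ℕ} (hm : IsStrictPartition m) {a r k : ℕ} (hk : 1 ≤ k) (ha : 2 ≤ a)
    (hmk : m k = a) (h : m (k + 1) ≠ a - 1) : RemB a r m k := by
  have := sp_step hm hk
  exact ⟨hk, hmk, sp_dec hm hk (by omega), fun h => by omega⟩

theorem add_of {m : ℕ → ℕ} (hm : IsStrictPartition m) {a r k : ℕ} (hk : 1 ≤ k) (ha : 2 ≤ a)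
    (hmk : m k = a - 1) (h : k = 1 ∨ m (k - 1) ≠ a) : AddB a r m k := by
  refine ⟨hk, by omega, sp_inc hm hk ?_, fun h => by omega⟩
  by_cases h1 : k = 1
  · exact Or.inl h1
  · have := sp_lt hm (i := k - 1) (j := k) (by omega) (by omega)
    omega

theorem cc_rem {m : ℕ → ℕ} (hm : IsStrictPartition m) {R : ℕ} (hR : 1 ≤ R) (hmR : m R = 0)
    {a r k : ℕ} (ha : a ≠ 0) (hk : RemB a r m k) (t : ℕ → ℤ) :
    cc R m (sT a r t) = cc R m t - del a r t - alp a r t := by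
  obtain ⟨hk1, hmk, hd, hpar⟩ := hk
  have hdd := dec_sp hk1 (by omega) hd
  by_cases h2 : 2 ≤ a
  · have := cc_ge2 hm hR hmR h2 (r := r) t
    rw [if_pos ⟨k, hk1, hmk⟩, if_neg] at this
    · rw [del, if_neg (by omega)]; linarith
    · rintro ⟨i, hi, hia⟩
      rcases Nat.lt_trichotomy i k with h | h | h
      · have := sp_lt hm hi h; omega
      · subst h; omega
      · have := sp_le hm (i := k + 1) (j := i) (by omega) h; omega
  · have e : a = 1 := by omega
    subst e
    obtain ⟨L, hL1, hL2⟩ := threshold hm (le_refl 1)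
    have := cc_one hm hR hmR hL1 hL2 (r := r) t
    rw [if_pos ⟨k, hk1, hmk⟩] at this
    have hp := hpar rfl
    have hkL : L = k := by
      have a1 := hL2 (k + 1)
      have a2 := hL2 k
      have a3 := sp_step hm hk1
      have a4 := hL1 (k + 1) (by omega)
      omega
    subst hkL
    rw [hp] at this
    rcases Nat.mod_two_eq_zero_or_one r with h | h
    · simp [h, del] at this ⊢; linarith
    · simp [h, del] at this ⊢; simp [alp, h] at *; linarith

theorem cc_add {m : ℕ → ℕ} (hm : IsStrictPartition m) {R : ℕ} (hR : 1 ≤ R) (hmR : m R = 0)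
    {a r k : ℕ} (ha : a ≠ 0) (hk : AddB a r m k) (t : ℕ → ℤ) :
    cc R m (sT a r t) = cc R m t - del a r t + alp a r t := by
  obtain ⟨hk1, hmk, hd, hpar⟩ := hk
  have hdd := inc_sp hk1 hd
  by_cases h2 : 2 ≤ a
  · have := cc_ge2 hm hR hmR h2 (r := r) t
    rw [if_pos (c := ∃ i, 1 ≤ i ∧ m i = a - 1) ⟨k, hk1, by omega⟩, if_neg] at this
    · rw [del, if_neg (by omega)]; linarith
    · clear this
      rintro ⟨i, hi, hia⟩
      rcases Nat.lt_trichotomy i k with h | h | h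
      · have := sp_le hm hi (j := k - 1) (by omega)
        omega
      · subst h; omega
      · have := sp_lt hm hk1 h; omega
  · have e : a = 1 := by omega
    subst e
    obtain ⟨L, hL1, hL2⟩ := threshold hm (le_refl 1)
    have := cc_one hm hR hmR hL1 hL2 (r := r) t
    have hp := hpar rfl
    have hkL : L + 1 = k := by
      have a1 := hL1 k hk1
      have a2 := hL2 (k - 1)
      omega
    rw [if_neg] at this
    · rcases Nat.mod_two_eq_zero_or_one r with h | h
      · have : L % 2 = 1 := by omega
        simp [h, del, this] at *; linarith
      · have : L % 2 = 0 := by omega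
        simp [h, del, this, alp] at *; linarith
    · rintro ⟨i, hi, hia⟩
      have a1 := hL2 i
      have a2 := sp_le hm hi (j := L) (by omega)
      have a3 := hL1 L
      simp at hmk
      rcases hdd with rfl | hdd
      · omega
      · have : k - 1 = L := by omega
        rw [this, hmk] at hdd
        omega

theorem cc_none {m : ℕ → ℕ} (hm : IsStrictPartition m) {R : ℕ} (hR : 1 ≤ R) (hmR : m R = 0)
    {a r : ℕ} (ha : a ≠ 0) (hk : ∀ k, ¬ RemB a r m k) (hk' : ∀ k, ¬ AddB a r m k) (t : ℕ → ℤ) :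
    cc R m (sT a r t) = cc R m t - del a r t := by
  by_cases h2 : 2 ≤ a
  · have := cc_ge2 hm hR hmR h2 (r := r) t
    have hiff : (∃ i, 1 ≤ i ∧ m i = a) ↔ (∃ i, 1 ≤ i ∧ m i = a - 1) := by
      constructor
      · rintro ⟨i, hi, hia⟩
        refine ⟨i + 1, by omega, ?_⟩
        by_contra hc
        exact hk i (rem_of hm hi h2 hia hc)
      · rintro ⟨i, hi, hia⟩
        by_contra hc
        refine hk' i (add_of hm hi h2 hia ?_)
        by_contra hc'
        push Not at hc'
        exact hc ⟨i - 1, by omega, hc'.2⟩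
    rw [del, if_neg (by omega)]
    by_cases h : ∃ i, 1 ≤ i ∧ m i = a
    · rw [if_pos h, if_pos (hiff.1 h)] at this; linarith
    · rw [if_neg h, if_neg (fun h' => h (hiff.2 h'))] at this; linarith
  · have e : a = 1 := by omega
    subst e
    obtain ⟨L, hL1, hL2⟩ := threshold hm (le_refl 1)
    have := cc_one hm hR hmR hL1 hL2 (r := r) t
    by_cases h : ∃ i, 1 ≤ i ∧ m i = 1
    · rw [if_pos h] at this
      obtain ⟨i, hi, hi1⟩ := h
      have hLr : ¬ (L % 2 = r % 2) := by
        intro hLr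
        have hiL : i = L := by
          have a1 := hL2 i
          have a2 := sp_lt hm hi (j := L)
          have a3 := hL1 L
          omega
        subst hiL
        exact hk i ⟨hi, hi1, sp_dec hm hi (Or.inr hi1), fun _ => hLr⟩
      rcases Nat.mod_two_eq_zero_or_one r with h | h
      · have : L % 2 = 1 := by omega
        simp [h, del, this] at *; linarith
      · have : L % 2 = 0 := by omega
        simp [h, del, this, alp] at *; linarith
    · rw [if_neg h] at this
      have hLr : L % 2 = r % 2 := by
        by_contra hLr
        refine hk' (L + 1) ⟨by omega, ?_, sp_inc hm (by omega) ?_, fun _ => by omega⟩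
        · have := hL2 (L + 1); omega
        · by_cases hL : L = 0
          · left; omega
          · right
            have a1 := hL1 L (by omega) (le_refl _)
            have a2 := hL2 (L + 1)
            have : m L ≠ 1 := fun h' => h ⟨L, by omega, h'⟩
            simp only [Nat.add_sub_cancel]
            omega
      rcases Nat.mod_two_eq_zero_or_one r with h | h
      · simp [h, del, hLr] at *; linarith
      · simp [h, del, hLr, alp] at *; linarith
def Compat (l : ℕ → ℕ) (x t : ℕ → ℤ) : Prop :=
  (∀ p, 1 ≤ p → l p ≠ 0 → x p = t (l p)) ∧
  (∀ p, l (p + 1) = 0 → (p = 0 ∨ l p ≠ 0) → x (p + 1) = if p % 2 = 1 then t 0 else - t 0) ∧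
  (∀ v p, 1 ≤ v → l (p + 1) < v → (p = 0 ∨ v < l p) → x (v + p + 1) = - t v)

theorem compat_hook {l : ℕ → ℕ} {x t : ℕ → ℤ} {r : ℕ} (hr : 1 ≤ r)
    (h0 : l r ≠ 0) (h1 : l (r + 1) = 0) (hc : Compat l x t) :
    x r + x (l r + r) = alp (l r) r t := by
  obtain ⟨c1, c0, c3⟩ := hc
  rw [c1 r hr h0]
  by_cases h2 : 2 ≤ l r
  · have := c3 (l r - 1) r (by omega) (by omega) (by omega)
    rw [show l r - 1 + r + 1 = l r + r by omega] at this
    rw [this, alp, if_neg (by omega)]; ring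
  · have e : l r = 1 := by omega
    have := c0 r h1 (by omega)
    rw [e, Nat.add_comm 1 r, this, alp]
    rcases Nat.mod_two_eq_zero_or_one r with h | h <;> simp [h]; ring

theorem compat_dec {l : ℕ → ℕ} {x t : ℕ → ℤ} (hl : IsStrictPartition l) {r : ℕ} (hr : 1 ≤ r)
    (h0 : l r ≠ 0) (h1 : l (r + 1) = 0) (hc : Compat l x t) :
    Compat (decR l r) x (sT (l r) r t) := by
  obtain ⟨c1, c0, c3⟩ := hc
  have hz : ∀ i, r < i → l i = 0 := fun i hi => last_zero hl hr h1 hi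
  have hgt : ∀ i, 1 ≤ i → i < r → l r < l i := fun i hi hir => by
    have := sp_lt hl hi hir; omega
  have dne : ∀ i, i ≠ r → decR l r i = l i := fun i hi => by simp [decR, hi]
  have deq : decR l r r = l r - 1 := by simp [decR]
  by_cases h2 : 2 ≤ l r
  · have hs : ¬ (l r = 1 ∧ r % 2 = 1) := by omega
    have s1 : sT (l r) r t (l r) = t (l r - 1) := by simp [sT, hs]
    have s2 : sT (l r) r t (l r - 1) = t (l r) := by
      simp only [sT, if_neg hs]
      rw [if_neg (by omega), if_pos (by omega)]
    have s3 : ∀ v, v ≠ l r → v ≠ l r - 1 → sT (l r) r t v = t v := by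
      intro v hv hv'
      simp only [sT, if_neg hs]
      rw [if_neg hv, if_neg (by omega)]
    refine ⟨?_, ?_, ?_⟩
    · intro p hp hlp
      by_cases hpr : p = r
      · subst hpr
        rw [deq, s2, c1 p hp h0]
      · rw [dne p hpr] at hlp ⊢
        have a1 := hz p
        have a2 := hgt p
        rw [c1 p hp hlp, s3 _ (by omega) (by omega)]
    · intro p hp hp'
      rw [s3 0 (by omega) (by omega)]
      have e1 : p + 1 ≠ r := by rintro rfl; rw [deq] at hp; omega
      rw [dne _ e1] at hp
      refine c0 p hp ?_
      by_cases hpr : p = r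
      · right; rw [hpr]; exact h0
      · rwa [dne _ hpr] at hp'
    · intro v p hv hv1 hv2
      by_cases hpr : p = r
      · subst hpr
        rw [dne _ (by omega)] at hv1
        rw [deq] at hv2
        rw [s3 v (by omega) (by omega)]
        exact c3 v p hv hv1 (by omega)
      · rw [dne p hpr] at hv2
        by_cases hpr1 : p + 1 = r
        · rw [hpr1, deq] at hv1
          by_cases hva : v = l r
          · subst hva
            rw [s1]
            have := c3 (l r - 1) r (by omega) (by omega) (by omega)
            rw [← this]; congr 1; omega
          · rw [s3 v hva (by omega)]
            exact c3 v p hv (by rw [hpr1]; omega) hv2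
        · rw [dne _ hpr1] at hv1
          have a1 := hz p
          have a2 := hgt (p + 1)
          rw [s3 v (by omega) (by omega)]
          exact c3 v p hv hv1 hv2
  · have e : l r = 1 := by omega
    rw [e]
    have e0 : decR l r r = 0 := by rw [deq, e]
    have hxr := c1 r hr h0
    rw [e] at hxr
    have hxr1 := c0 r h1 (Or.inr h0)
    have sv : ∀ v, 2 ≤ v → sT 1 r t v = t v := by
      intro v hv
      simp only [sT]
      split
      · rw [if_neg (by omega), if_neg (by omega)]
      · rw [if_neg (by omega), if_neg (by omega)]
    refine ⟨?_, ?_, ?_⟩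
    · intro p hp hlp
      by_cases hpr : p = r
      · subst hpr; exact absurd e0 hlp
      · rw [dne p hpr] at hlp ⊢
        have a1 := hz p
        have a2 := hgt p
        rw [c1 p hp hlp, sv _ (by omega)]
    · intro p hp hp'
      have hpr : p + 1 = r := by
        by_contra hne
        rw [dne _ hne] at hp
        by_cases hpr : p = r
        · subst hpr; rw [e0] at hp'; omega
        · rw [dne _ hpr] at hp'
          have a1 := hz p
          have a2 := hgt (p + 1)
          omega
      subst hpr
      rw [hxr]
      rcases Nat.mod_two_eq_zero_or_one p with h | h
      · have : (p + 1) % 2 = 1 := by omega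
        simp [sT, h, this]
      · have : (p + 1) % 2 = 0 := by omega
        simp [sT, h, this]
    · intro v p hv hv1 hv2
      by_cases hpr : p = r
      · subst hpr; rw [e0] at hv2; omega
      · rw [dne p hpr] at hv2
        by_cases hpr1 : p + 1 = r
        · by_cases hv1 : v = 1
          · subst hv1
            rw [show 1 + p + 1 = r + 1 by omega, hxr1]
            rcases Nat.mod_two_eq_zero_or_one r with h | h <;> simp [sT, h]
          · rw [sv v (by omega)]
            exact c3 v p hv (by rw [hpr1]; omega) hv2
        · rw [dne _ hpr1] at hv1
          have a1 := hz p
          have a2 := hgt (p + 1)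
          rw [sv v (by omega)]
          exact c3 v p hv hv1 hv2

theorem chev_step {l : ℕ → ℕ} {x t : ℕ → ℤ} (hl : IsStrictPartition l) {r R : ℕ} (hr : 1 ≤ r)
    (h0 : l r ≠ 0) (h1 : l (r + 1) = 0) (hR : 1 ≤ R) (hlR : l R = 0) (hc : Compat l x t)
    (IH : ∀ m, IsStrictPartition m → m R = 0 →
      (cc R (decR l r) (sT (l r) r t) - cc R m (sT (l r) r t)) * FF x (decR l r) m =
      ∑ i ∈ Finset.Icc 1 R, if IsStrictPartition (incR m i) then FF x (decR l r) (incR m i) else 0)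
    (m : ℕ → ℕ) (hm : IsStrictPartition m) (hmR : m R = 0) :
    (cc R l t - cc R m t) * FF x l m =
      ∑ i ∈ Finset.Icc 1 R, if IsStrictPartition (incR m i) then FF x l (incR m i) else 0 := by
  have hl' := last_dec hl hr h0 h1
  have hook := compat_hook hr h0 h1 hc
  have hrl : RemB (l r) r l r := ⟨hr, rfl, hl', fun _ => rfl⟩
  have hrR : r < R := le_R hl hR hlR h0
  have hcl : cc R (decR l r) (sT (l r) r t) = cc R l t - del (l r) r t := by
    rw [cc_dec h0 hrl hrR.le, cc_rem hl hR hlR h0 hrl, alp_sT h0]; ring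
  rw [hcl] at IH
  set a := l r with ha
  by_cases hrem : ∃ k, RemB a r m k
  · obtain ⟨k, hk⟩ := hrem
    obtain ⟨hk1, hmk, hkd, hkp⟩ := id hk
    have hkR : k < R := le_R hm hR hmR (by omega)
    have I1 := IH m hm hmR
    have I2 := IH (decR m k) hkd (by simp [decR, hmR])
    rw [cc_dec h0 hk hkR.le, alp_sT h0, cc_rem hm hR hmR h0 hk] at I2
    rw [cc_rem hm hR hmR h0 hk] at I1
    rw [FF_rem x hl hm hr h0 h1 hk, ← ha, hook]
    have hkmem : k ∈ Finset.Icc 1 R := Finset.mem_Icc.2 ⟨hk1, hkR.le⟩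
    have hterm : ∀ i ∈ Finset.Icc 1 R,
        (if IsStrictPartition (incR m i) then FF x l (incR m i) else 0) =
        (if IsStrictPartition (incR m i) then FF x (decR l r) (incR m i) else 0) +
        alp a r t * ((if IsStrictPartition (incR (decR m k) i) then
          FF x (decR l r) (incR (decR m k) i) else 0) -
          if i = k then FF x (decR l r) m else 0) := by
      intro i hi
      have hi1 := (Finset.mem_Icc.1 hi).1
      by_cases hik : i = k
      · subst hik
        rw [inc_dec (by omega), if_pos hm, if_pos rfl]
        by_cases hs : IsStrictPartition (incR m i)
        · rw [if_pos hs, if_pos hs, FF_norem x hl hs hr h0 h1]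
          · ring
          · intro k' hk'
            have e1 : k' ≠ i := by
              rintro rfl
              have := hk'.2.1
              simp [incR] at this; omega
            have e2 := hk'.2.1
            simp only [incR, if_neg e1] at e2
            exact e1 (sp_inj hm hk'.1 hi1 (by omega) (by omega))
        · rw [if_neg hs, if_neg hs]; ring
      · rw [if_neg hik]
        by_cases hs : IsStrictPartition (incR m i)
        · rw [if_pos hs, if_pos hs]
          by_cases hs' : IsStrictPartition (incR (decR m k) i)
          · rw [if_pos hs']
            have : RemB a r (incR m i) k := by
              refine ⟨hk1, ?_, ?_, hkp⟩
              · simp only [incR, if_neg (Ne.symm hik)]; exact hmk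
              · rw [dec_inc_comm m hik]; exact hs'
            rw [FF_rem x hl hs hr h0 h1 this, ← ha, hook, dec_inc_comm m hik]; ring
          · rw [if_neg hs', FF_norem x hl hs hr h0 h1]
            · ring
            · intro k' hk'
              have e : k' = k := by
                refine sp_inj hs hk'.1 hk1 ?_ ?_
                · rw [hk'.2.1]; simp only [incR, if_neg (Ne.symm hik)]; omega
                · rw [hk'.2.1]; exact h0
              subst e
              apply hs'
              rw [← dec_inc_comm m hik]; exact hk'.2.2.1
        · rw [if_neg hs, if_neg hs, if_neg]
          · ring
          · intro hs'
            apply hs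
            have := inc_sp hi1 hs'
            refine sp_inc hm hi1 ?_
            simp only [decR, if_neg hik] at this
            by_cases h : i - 1 = k
            · rw [if_pos h] at this; omega
            · rw [if_neg h] at this; omega
    rw [Finset.sum_congr rfl hterm, Finset.sum_add_distrib, ← Finset.mul_sum,
      Finset.sum_sub_distrib, ← I1, ← I2, Finset.sum_ite_eq' , if_pos hkmem]
    ring
  · push Not at hrem
    rw [FF_norem x hl hm hr h0 h1 hrem]
    have I1 := IH m hm hmR
    by_cases hadd : ∃ k, AddB a r m k
    · obtain ⟨k, hk⟩ := hadd
      obtain ⟨hk1, hmk, hkd, hkp⟩ := id hk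
      have hkd' := inc_sp hk1 hkd
      have hkR : k ≤ R := by
        by_contra hc
        have := le_R hm hR hmR (i := k - 1) (by omega)
        omega
      have hkmem : k ∈ Finset.Icc 1 R := Finset.mem_Icc.2 ⟨hk1, hkR⟩
      rw [cc_add hm hR hmR h0 hk] at I1
      have hterm : ∀ i ∈ Finset.Icc 1 R,
          (if IsStrictPartition (incR m i) then FF x l (incR m i) else 0) =
          (if IsStrictPartition (incR m i) then FF x (decR l r) (incR m i) else 0) +
          alp a r t * (if i = k then FF x (decR l r) m else 0) := by
        intro i hi
        have hi1 := (Finset.mem_Icc.1 hi).1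
        by_cases hik : i = k
        · subst hik
          have : RemB a r (incR m i) i := by
            refine ⟨hk1, by simp only [incR, if_true]; exact hmk, ?_, hkp⟩
            rw [dec_inc]; exact hm
          rw [if_pos hkd, if_pos hkd, if_pos rfl, FF_rem x hl hkd hr h0 h1 this, ← ha, hook,
            dec_inc]
        · rw [if_neg hik]
          by_cases hs : IsStrictPartition (incR m i)
          · rw [if_pos hs, if_pos hs, FF_norem x hl hs hr h0 h1]
            · ring
            · rintro k' ⟨b1, b2, b3, b4⟩
              have hid := inc_sp hi1 hs
              by_cases hk'i : k' = i
              · subst hk'i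
                simp only [incR, if_true] at b2
                by_cases h2 : 2 ≤ a
                · exact hik (sp_inj hm hi1 hk1 (by omega) (by omega))
                · have q1 : ∀ p, 1 ≤ p → m p = 0 → ∀ q, p ≤ q → m q = 0 := by
                    intro p hp hmp q hpq
                    rcases Nat.eq_or_lt_of_le hpq with h | h
                    · rw [← h]; exact hmp
                    · have := sp_lt hm hp h; omega
                  rcases Nat.lt_or_gt_of_ne hik with h | h
                  · have := q1 k' hi1 (by omega) (k - 1) (by omega); omega
                  · have := q1 k hk1 (by omega) (k' - 1) (by omega); omega
              · simp only [incR, if_neg hk'i] at b2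
                have hlt : k' < k := by
                  by_contra hc
                  have e : k ≠ k' := by rintro rfl; omega
                  have := sp_lt hm hk1 (j := k') (by omega)
                  omega
                by_cases hkk : k' = k - 1
                · rw [← hkk] at hkd'
                  omega
                · have e1 := sp_lt hm b1 (j := k - 1) (by omega)
                  omega
          · rw [if_neg hs, if_neg hs]; ring
      rw [Finset.sum_congr rfl hterm, Finset.sum_add_distrib, ← Finset.mul_sum,
        ← I1, Finset.sum_ite_eq', if_pos hkmem]
      ring
    · push Not at hadd
      rw [cc_none hm hR hmR h0 hrem hadd] at I1
      have hterm : ∀ i ∈ Finset.Icc 1 R,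
          (if IsStrictPartition (incR m i) then FF x l (incR m i) else 0) =
          (if IsStrictPartition (incR m i) then FF x (decR l r) (incR m i) else 0) := by
        intro i hi
        have hi1 := (Finset.mem_Icc.1 hi).1
        by_cases hs : IsStrictPartition (incR m i)
        · rw [if_pos hs, if_pos hs, FF_norem x hl hs hr h0 h1]
          rintro k' ⟨b1, b2, b3, b4⟩
          by_cases hk'i : k' = i
          · subst hk'i
            simp only [incR, if_true] at b2
            exact hadd k' ⟨hi1, b2, hs, b4⟩
          · have b3' := dec_sp b1 (by omega) b3
            simp only [incR, if_neg hk'i] at b2 b3'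
            refine hrem k' ⟨b1, b2, sp_dec hm b1 ?_, b4⟩
            by_cases h : k' + 1 = i
            · rw [if_pos h] at b3'; omega
            · rw [if_neg h] at b3'; omega
        · rw [if_neg hs, if_neg hs]
      rw [Finset.sum_congr rfl hterm, ← I1]
      ring

theorem chev (x : ℕ → ℤ) (R : ℕ) (hR : 1 ≤ R) (n : ℕ) : ∀ (l : ℕ → ℕ), IsStrictPartition l →
    l R = 0 → ∑ i ∈ Finset.Icc 1 R, l i = n → ∀ t, Compat l x t → ∀ m, IsStrictPartition m →
    m R = 0 → (cc R l t - cc R m t) * FF x l m =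
      ∑ i ∈ Finset.Icc 1 R, if IsStrictPartition (incR m i) then FF x l (incR m i) else 0 := by
  induction n with
  | zero =>
    intro l hl hlR hsum t _ m hm hmR
    have hl0 : ∀ i, l i = 0 := by
      intro i
      by_contra hne
      have h1 := le_R hl hR hlR hne
      have h2 : 1 ≤ i := by
        by_contra hc
        have : i = 0 := by omega
        subst this; exact hne hl.1
      rw [Finset.sum_eq_zero_iff] at hsum
      exact hne (hsum i (Finset.mem_Icc.2 ⟨h2, h1.le⟩))
    have key : ∀ m, IsStrictPartition m → ∀ i, 1 ≤ i → m i ≠ 0 → FF x l m = 0 := by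
      intro m hm i hi hmi
      apply FF_zero x hl
      intro hsub
      have := (mem_cD hl _).1 (hsub ((mem_cD hm (i, i + 1)).2 (by simp only; omega)))
      simp only [hl0] at this
      omega
    rw [Finset.sum_eq_zero]
    · by_cases hm0 : ∃ i, 1 ≤ i ∧ m i ≠ 0
      · obtain ⟨i, hi, hmi⟩ := hm0
        rw [key m hm i hi hmi, mul_zero]
      · push Not at hm0
        have : cc R l t = cc R m t := by
          unfold cc
          refine Finset.sum_congr rfl fun i hi => ?_
          rw [if_pos (hl0 i), if_pos (hm0 i (Finset.mem_Icc.1 hi).1)]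
        rw [this, sub_self, zero_mul]
    · intro i hi
      split
      · rename_i hs
        exact key _ hs i (Finset.mem_Icc.1 hi).1 (by simp [incR])
      · rfl
  | succ n ih =>
    intro l hl hlR hsum t hc m hm hmR
    obtain ⟨r, hr1, hr2⟩ := threshold hl (le_refl 1)
    have hr : 1 ≤ r := by
      by_contra hcon
      have : ∑ i ∈ Finset.Icc 1 R, l i = 0 := by
        refine Finset.sum_eq_zero fun i hi => ?_
        have := hr2 i (by have := (Finset.mem_Icc.1 hi).1; omega)
        omega
      omega
    have h0 : l r ≠ 0 := by have := hr1 r hr le_rfl; omega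
    have h1 : l (r + 1) = 0 := by have := hr2 (r + 1) (by omega); omega
    have hrR : r < R := le_R hl hR hlR h0
    have hl' := last_dec hl hr h0 h1
    have hsum' : ∑ i ∈ Finset.Icc 1 R, decR l r i = n := by
      have e : ∑ i ∈ Finset.Icc 1 R, l i =
          ∑ i ∈ Finset.Icc 1 R, (decR l r i + if i = r then 1 else 0) := by
        refine Finset.sum_congr rfl fun i _ => ?_
        simp only [decR]
        by_cases h : i = r
        · subst h; simp; omega
        · simp [h]
      rw [Finset.sum_add_distrib, Finset.sum_ite_eq',
        if_pos (Finset.mem_Icc.2 ⟨hr, hrR.le⟩)] at e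
      omega
    exact chev_step hl hr h0 h1 hR hlR hc
      (fun m hm hmR => ih (decR l r) hl' (by simp [decR, hlR]) hsum' _
        (compat_dec hl hr h0 h1 hc) m hm hmR) m hm hmR
theorem spLen {l : ℕ → ℕ} (hl : IsStrictPartition l) :
    (∀ i, 1 ≤ i → i ≤ spLength l → l i ≠ 0) ∧ ∀ i, spLength l < i → l i = 0 := by
  obtain ⟨k, h1, h2⟩ := threshold hl (le_refl 1)
  have : spLength l = k := by
    unfold spLength
    have : (Finset.Icc 1 (l 1)).filter (fun i => l i ≠ 0) = Finset.Icc 1 k := by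
      ext i
      simp only [Finset.mem_filter, Finset.mem_Icc]
      constructor
      · rintro ⟨⟨a, b⟩, c⟩
        refine ⟨a, ?_⟩
        by_contra h
        have := h2 i (by omega)
        omega
      · rintro ⟨a, b⟩
        have := h1 i a b
        have := sp_le hl (le_refl 1) a
        omega
    rw [this]; simp
  rw [this]
  exact ⟨fun i a b => by have := h1 i a b; omega, fun i a => by have := h2 i a; omega⟩

theorem colB_eq {l : ℕ → ℕ} (hl : IsStrictPartition l) {k p : ℕ} (hk : p ≤ k)
    (h : ∀ i, 1 ≤ i → i ≤ k → (k < l i + i ↔ i ≤ p)) : colB l k = p := by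
  unfold colB
  have : (cellsB l).filter (fun p => p.2 = k) = (Finset.Icc 1 p).image (fun i => (i, k)) := by
    ext ⟨i, j⟩
    simp only [cellsB, Finset.mem_filter, Finset.mem_product, Finset.mem_Icc, Finset.mem_image,
      Prod.mk.injEq]
    constructor
    · rintro ⟨⟨⟨⟨a, b⟩, c, d⟩, e, f⟩, g⟩
      subst g
      exact ⟨i, ⟨a, (h i a e).1 f⟩, rfl, rfl⟩
    · rintro ⟨i', ⟨a, b⟩, c, d⟩
      subst c; subst d
      have := (h i' a (by omega)).2 b
      have := sp_le hl (le_refl 1) a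
      omega
  rw [this, Finset.card_image_of_injective _ (fun a b h => by simpa using h)]
  simp

theorem compat_xD {l : ℕ → ℕ} (hl : IsStrictPartition l) :
    Compat l (xD l) (fun v => (v : ℤ)) := by
  obtain ⟨h1, h2⟩ := spLen hl
  refine ⟨?_, ?_, ?_⟩
  · intro p hp h
    have : p ≤ spLength l := by
      by_contra h'
      exact h (h2 p (by omega))
    simp [xD, this]
  · intro p h3 h4
    have e : ¬ (p + 1 ≤ spLength l) := fun h' => h1 _ (by omega) h' h3
    have : colB l p = p := colB_eq hl (le_refl p) (fun i hi hip => by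
      have := sp_le hl hi hip
      omega)
    simp [xD, e, this]
  · intro v p hv h3 h4
    have e : ¬ (v + p + 1 ≤ spLength l) := fun h' => by
      have := h1 _ (by omega) h'
      have := sp_le hl (i := p + 1) (j := v + p + 1) (by omega) (by omega)
      omega
    have : colB l (v + p) = p := colB_eq hl (by omega) (fun i hi hip => by
      constructor
      · intro h
        by_contra h'
        have := sp_le hl (i := p + 1) (j := i) (by omega) (by omega)
        omega
      · intro h
        have := sp_le hl hi h
        omega)
    simp [xD, e, this]
    ring

theorem hD_eq {l : ℕ → ℕ} (hl : IsStrictPartition l) {p : ℕ × ℕ} (hp : p ∈ cellsD l) :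
    hD l p = xD l p.1 + xD l p.2 := by
  obtain ⟨h1, h2⟩ := spLen hl
  rw [mem_cD hl] at hp
  have : p.1 ≤ spLength l := by
    by_contra h'
    have := h2 p.1 (by omega)
    omega
  unfold hD xD
  rw [if_pos this]
  split_ifs
  · rfl
  · ring

theorem sum_hD {l : ℕ → ℕ} (hl : IsStrictPartition l) (n : ℕ → ℕ) :
    ∑ D ∈ ED l n, ∏ p ∈ D, hD l p = FF (xD l) l n := by
  unfold FF
  refine Finset.sum_congr rfl fun D hD' => Finset.prod_congr rfl fun p hp => ?_
  exact hD_eq hl ((mem_ED.1 hD').1 hp)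

theorem size_eq {l : ℕ → ℕ} (hl : IsStrictPartition l) {R : ℕ} (h : l 1 ≤ R) :
    spSize l = ∑ i ∈ Finset.Icc 1 R, l i := by
  unfold spSize
  refine Finset.sum_subset (Finset.Icc_subset_Icc_right h) fun i hi hi' => ?_
  simp only [Finset.mem_Icc] at hi hi'
  have := sp_le hl (le_refl 1) hi.1
  omega

theorem cc_size {l : ℕ → ℕ} (hl : IsStrictPartition l) {R : ℕ} (h : l 1 ≤ R) :
    cc R l (fun v => (v : ℤ)) = (spSize l : ℤ) := by
  rw [size_eq hl h, cc]
  push_cast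
  refine Finset.sum_congr rfl fun i _ => ?_
  split_ifs with h <;> simp [h]

theorem sum_incR (m : ℕ → ℕ) {r R : ℕ} (hr : 1 ≤ r) (hR : r ≤ R) :
    ∑ i ∈ Finset.Icc 1 R, incR m r i = ∑ i ∈ Finset.Icc 1 R, m i + 1 := by
  have : ∀ i ∈ Finset.Icc 1 R, incR m r i = m i + if i = r then 1 else 0 := by
    intro i _
    unfold incR; split_ifs <;> rfl
  rw [Finset.sum_congr rfl this, Finset.sum_add_distrib, Finset.sum_ite_eq', if_pos]
  simp; omega

theorem covers_inc {m : ℕ → ℕ} (hm : IsStrictPartition m) {r : ℕ} (hr : 1 ≤ r)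
    (h : IsStrictPartition (incR m r)) : CoversD m (incR m r) := by
  constructor
  · intro p hp
    rw [mem_cD hm] at hp
    rw [mem_cD h]
    have : m p.1 ≤ incR m r p.1 := by unfold incR; split_ifs <;> omega
    omega
  · have e1 : m 1 ≤ m 1 + 1 + r := by omega
    have e2 : incR m r 1 ≤ m 1 + 1 + r := by unfold incR; split_ifs <;> omega
    rw [size_eq hm e1, size_eq h e2]
    exact sum_incR m hr (by omega)

theorem inc_covers {m n : ℕ → ℕ} (hm : IsStrictPartition m) (hn : IsStrictPartition n)
    (h : CoversD m n) : ∃ r, 1 ≤ r ∧ r ≤ m 1 + 2 ∧ n = incR m r := by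
  obtain ⟨h1, h2⟩ := h
  have hle : ∀ i, 1 ≤ i → m i ≤ n i := by
    intro i hi
    by_contra h'
    have := h1 ((mem_cD hm (i, m i + i)).2 (by simp only; omega))
    rw [mem_cD hn] at this
    simp only at this
    omega
  have hex : ∃ r, 1 ≤ r ∧ m r < n r := by
    by_contra h'
    push Not at h'
    have : n = m := by
      funext i
      rcases Nat.eq_zero_or_pos i with h0 | h0
      · subst h0; rw [hm.1, hn.1]
      · exact le_antisymm (h' i h0) (hle i h0)
    rw [this] at h2
    omega
  obtain ⟨r, hr, hrn⟩ := hex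
  have key : ∀ i, 1 ≤ i → incR m r i = n i := by
    intro i hi
    have hge : ∀ j ∈ Finset.Icc 1 (m 1 + n 1 + r + i), incR m r j ≤ n j := by
      intro j hj
      rw [Finset.mem_Icc] at hj
      have := hle j hj.1
      unfold incR
      split_ifs with hjr
      · subst hjr; omega
      · exact this
    have hs := sum_incR m hr (R := m 1 + n 1 + r + i) (by omega)
    rw [size_eq hm (R := m 1 + n 1 + r + i) (by omega),
      size_eq hn (R := m 1 + n 1 + r + i) (by omega), ← hs] at h2
    exact (Finset.sum_eq_sum_iff_of_le hge).1 h2.symm i (by simp; omega)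
  refine ⟨r, hr, ?_, ?_⟩
  · by_contra h'
    have e1 := key (m 1 + 1 + 1) (by omega)
    have e2 := sp_le hm (i := 1) (j := m 1 + 1 + 1) (le_refl 1) (by omega)
    have e3 := last_zero hn (r := m 1 + 1) (i := r) (by omega) (by
      rw [← e1]; unfold incR; rw [if_neg (by omega)]; omega) (by omega)
    omega
  · funext i
    rcases Nat.eq_zero_or_pos i with h0 | h0
    · subst h0; rw [hn.1]; unfold incR; rw [if_neg (by omega), hm.1]
    · exact (key i h0).symm

theorem incR_inj (m : ℕ → ℕ) {r s : ℕ} (h : incR m r = incR m s) : r = s := by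
  by_contra h'
  have := congrFun h r
  simp [incR, h'] at this

theorem rhs_eq (x : ℕ → ℤ) {l m : ℕ → ℕ} (hl : IsStrictPartition l) (hm : IsStrictPartition m)
    {R : ℕ} (hR : m 1 + 2 ≤ R) :
    ∑ᶠ n ∈ {n : ℕ → ℕ | IsStrictPartition n ∧ CoversD m n ∧ cellsD n ⊆ cellsD l}, FF x l n =
      ∑ i ∈ Finset.Icc 1 R, if IsStrictPartition (incR m i) then FF x l (incR m i) else 0 := by
  have hset : {n : ℕ → ℕ | IsStrictPartition n ∧ CoversD m n ∧ cellsD n ⊆ cellsD l} =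
      ↑(((Finset.Icc 1 R).filter fun i => IsStrictPartition (incR m i) ∧
        cellsD (incR m i) ⊆ cellsD l).image (incR m)) := by
    ext n
    simp only [Set.mem_setOf_eq, Finset.coe_image, Set.mem_image, Finset.mem_coe,
      Finset.mem_filter, Finset.mem_Icc]
    constructor
    · rintro ⟨a, b, c⟩
      obtain ⟨r, h1, h2, h3⟩ := inc_covers hm a b
      exact ⟨r, ⟨⟨h1, by omega⟩, h3 ▸ a, h3 ▸ c⟩, h3.symm⟩
    · rintro ⟨r, ⟨⟨h1, h2⟩, a, c⟩, h3⟩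
      subst h3
      exact ⟨a, covers_inc hm h1 a, c⟩
  rw [hset, finsum_mem_coe_finset, Finset.sum_image (fun a _ b _ h => incR_inj m h),
    Finset.sum_filter]
  refine Finset.sum_congr rfl fun i _ => ?_
  by_cases h1 : IsStrictPartition (incR m i)
  · by_cases h2 : cellsD (incR m i) ⊆ cellsD l
    · simp [h1, h2]
    · simp [h2, FF_zero x hl h2]
  · simp [h1]

/-- The recursion (6) for type D hook products over excited diagrams. -/
theorem statement7 (l m : ℕ → ℕ) (hl : IsStrictPartition l) (hm : IsStrictPartition m) :
    ((spSize l : ℤ) - (spSize m : ℤ)) * (∑ D ∈ ED l m, ∏ p ∈ D, hD l p) =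
      ∑ᶠ n ∈ {n : ℕ → ℕ | IsStrictPartition n ∧ CoversD m n ∧ cellsD n ⊆ cellsD l},
        ∑ D ∈ ED l n, ∏ p ∈ D, hD l p := by
  simp only [sum_hD hl]
  have z1 : l (l 1 + m 1 + 2) = 0 := by
    have := sp_le hl (i := 1) (j := l 1 + m 1 + 2) (le_refl 1) (by omega)
    omega
  have z2 : m (l 1 + m 1 + 2) = 0 := by
    have := sp_le hm (i := 1) (j := l 1 + m 1 + 2) (le_refl 1) (by omega)
    omega
  rw [rhs_eq (xD l) hl hm (R := l 1 + m 1 + 2) (by omega),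
    ← cc_size hl (R := l 1 + m 1 + 2) (by omega), ← cc_size hm (R := l 1 + m 1 + 2) (by omega)]
  exact chev (xD l) (l 1 + m 1 + 2) (by omega) _ l hl z1 rfl _ (compat_xD hl) m hm z2
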